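/- arXiv:1307.6107 — 9 statements merged into one kernel-verified Lean document; each statement's English description precedes it below -/
import Mathlib

section
/- Let n and m be integers greater than 1, let V = (ZMod n)^m be the free module of rank m over ZMod n, and let Γ be a subgroup of the general linear group GL_m(ZMod n) acting naturally on V. Suppose W is a ZMod n-submodule of V that is Γ-invariant (g • w ∈ W for all g ∈ Γ and w ∈ W) and on which Γ acts abelianly, i.e. (A * B) • w = (B * A) • w for all A, B ∈ Γ and all w ∈ W. Let I(Γ) denote the index of Γ in GL_m(ZMod n). Then the cardinality of W satisfies |W| ≤ I(Γ)^(1 + m/2) · (π²/6)^((m-1)(1 + m/2)) (the exponents being real numbers and π²/6 = ζ(2)). -/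
open Matrix

theorem one_le_prod_one_sub_inv_pow_mul_zeta_two (s : Finset ℕ) (hs : ∀ p ∈ s, p.Prime)
    {m : ℕ} (hm : 2 ≤ m) :
    1 ≤ (∏ p ∈ s, (1 - ((p : ℝ) ^ m)⁻¹)) * (Real.pi ^ 2 / 6) := by
  let f : ℕ →* ℝ :=
    { toFun := fun k => ((k : ℝ) ^ 2)⁻¹
      map_one' := by simp
      map_mul' := fun a b => by push_cast; rw [mul_pow, mul_inv] }
  have hf : HasSum f (Real.pi ^ 2 / 6) := by
    simpa [f, one_div] using hasSum_zeta_two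
  have hEuler := EulerProduct.prod_filter_prime_geometric_eq_tsum_factoredNumbers hf.summable s
  rw [Finset.filter_true_of_mem hs] at hEuler
  have hle : ∏ p ∈ s, (1 - f p)⁻¹ ≤ Real.pi ^ 2 / 6 := by
    rw [hEuler, ← hf.tsum_eq]
    exact hf.summable.tsum_subtype_le _ _ (fun k => inv_nonneg.2 (by positivity))
  have hpos : ∀ p ∈ s, 0 < 1 - f p := fun p hp => by
    have h2 : (2 : ℝ) ≤ p := by exact_mod_cast (hs p hp).two_le
    have : f p < 1 := inv_lt_one_of_one_lt₀ (by nlinarith)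
    linarith
  have hprod : 0 < ∏ p ∈ s, (1 - f p) := Finset.prod_pos hpos
  have hmono : ∏ p ∈ s, (1 - f p) ≤ ∏ p ∈ s, (1 - ((p : ℝ) ^ m)⁻¹) := by
    refine Finset.prod_le_prod (fun p hp => (hpos p hp).le) fun p hp => ?_
    have h1 : (1 : ℝ) ≤ p := by exact_mod_cast (hs p hp).one_le
    have : ((p : ℝ) ^ m)⁻¹ ≤ ((p : ℝ) ^ 2)⁻¹ := by gcongr
    exact sub_le_sub_left this 1
  rw [Finset.prod_inv_distrib, inv_le_iff_one_le_mul₀ hprod] at hle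
  calc 1 ≤ (Real.pi ^ 2 / 6) * ∏ p ∈ s, (1 - f p) := hle
    _ ≤ (∏ p ∈ s, (1 - ((p : ℝ) ^ m)⁻¹)) * (Real.pi ^ 2 / 6) := by
      rw [mul_comm]; gcongr

theorem card_filter_forall_div_nsmul_ne_zero {A : Type*} [AddCommGroup A] [Finite A] {N m : ℕ}
    (htors : ∀ e, e ∣ N → Nat.card {v : A // e • v = 0} = e ^ m) (s : Finset ℕ) :
    ∀ d, d ∣ N → (∀ p ∈ s, p.Prime ∧ p ∣ d) →
      (Nat.card {v : A // d • v = 0 ∧ ∀ p ∈ s, (d / p) • v ≠ 0} : ℝ) =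
        (d : ℝ) ^ m * ∏ p ∈ s, (1 - ((p : ℝ) ^ m)⁻¹) := by
  classical
  have := Fintype.ofFinite A
  induction s using Finset.induction_on with
  | empty =>
    intro d hd _
    simp only [Finset.notMem_empty, false_imp_iff, implies_true, and_true, htors d hd,
      Finset.prod_empty, mul_one, Nat.cast_pow]
  | insert q s hq ih =>
    intro d hd hs
    obtain ⟨hqp, hqd⟩ := hs q (Finset.mem_insert_self q s)
    have hs' : ∀ p ∈ s, p.Prime ∧ p ∣ d := fun p hp => hs p (Finset.mem_insert_of_mem hp)
    have hcop : ∀ p ∈ s, Nat.Coprime p q := fun p hp =>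
      (Nat.coprime_primes (hs' p hp).1 hqp).2 (by rintro rfl; exact hq hp)
    obtain ⟨c, rfl⟩ := hqd
    have hpc : ∀ p ∈ s, p ∣ c := fun p hp => (hcop p hp).dvd_of_dvd_mul_left (hs' p hp).2
    have hq0 : 0 < q := hqp.pos
    have hc := ih c ((dvd_mul_left c q).trans hd) fun p hp => ⟨(hs' p hp).1, hpc p hp⟩
    have hqc := ih (q * c) hd hs'
    have hsplit : Nat.card {v : A // (q * c) • v = 0 ∧ ∀ p ∈ s, (q * c / p) • v ≠ 0} =
        Nat.card {v : A // (q * c) • v = 0 ∧ ∀ p ∈ insert q s, (q * c / p) • v ≠ 0} +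
        Nat.card {v : A // c • v = 0 ∧ ∀ p ∈ s, (c / p) • v ≠ 0} := by
      simp only [Nat.card_eq_fintype_card, Fintype.card_subtype]
      rw [← Finset.card_filter_add_card_filter_not (p := fun v : A => c • v ≠ 0)]
      simp only [Finset.filter_filter]
      congr 2
      · ext v
        simp only [Finset.mem_filter, Finset.mem_univ, true_and, Finset.forall_mem_insert,
          Nat.mul_div_cancel_left c hq0]
        tauto
      · ext v
        simp only [Finset.mem_filter, Finset.mem_univ, true_and, not_not]
        constructor
        · rintro ⟨⟨-, h⟩, hv⟩
          refine ⟨hv, fun p hp h0 => h p hp ?_⟩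
          rw [Nat.mul_div_assoc _ (hpc p hp), mul_smul, h0, smul_zero]
        · rintro ⟨hv, h⟩
          refine ⟨⟨by rw [mul_smul, hv, smul_zero], fun p hp h0 => h p hp ?_⟩, hv⟩
          rw [Nat.mul_div_assoc _ (hpc p hp)] at h0
          have h1 : addOrderOf ((c / p) • v) ∣ q := addOrderOf_dvd_of_nsmul_eq_zero (by
            rwa [← mul_smul])
          have h2 : addOrderOf ((c / p) • v) ∣ p := addOrderOf_dvd_of_nsmul_eq_zero (by
            rwa [← mul_smul, Nat.mul_div_cancel' (hpc p hp)])
          exact AddMonoid.addOrderOf_eq_one_iff.1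
            (Nat.eq_one_of_dvd_coprimes (hcop p hp) h2 h1)
    rw [hsplit] at hqc
    push_cast at hqc hc ⊢
    rw [Finset.prod_insert hq, eq_sub_of_add_eq hqc, hc]
    have : (q : ℝ) ≠ 0 := by exact_mod_cast hq0.ne'
    rw [mul_pow]
    field_simp

theorem pow_le_card_addOrderOf_eq_mul_zeta_two {A : Type*} [AddCommGroup A] [Finite A] {N m : ℕ}
    (hN : N ≠ 0) (hm : 2 ≤ m) (htors : ∀ e, e ∣ N → Nat.card {v : A // e • v = 0} = e ^ m)
    {d : ℕ} (hd : d ∣ N) :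
    (d : ℝ) ^ m ≤ Nat.card {v : A // addOrderOf v = d} * (Real.pi ^ 2 / 6) := by
  have hd0 : d ≠ 0 := ne_zero_of_dvd_ne_zero hN hd
  have hcard := card_filter_forall_div_nsmul_ne_zero htors d.primeFactors d hd
    fun p hp => ⟨Nat.prime_of_mem_primeFactors hp, Nat.dvd_of_mem_primeFactors hp⟩
  have hle : Nat.card {v : A // d • v = 0 ∧ ∀ p ∈ d.primeFactors, (d / p) • v ≠ 0} ≤
      Nat.card {v : A // addOrderOf v = d} := by
    refine Nat.card_mono (Set.toFinite _) fun v hv => ?_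
    exact addOrderOf_eq_of_nsmul_and_div_prime_nsmul (Nat.pos_of_ne_zero hd0) hv.1
      fun p hp hpd => hv.2 p (Nat.mem_primeFactors.2 ⟨hp, hpd, hd0⟩)
  have hzeta := one_le_prod_one_sub_inv_pow_mul_zeta_two d.primeFactors
    (fun p hp => Nat.prime_of_mem_primeFactors hp) hm
  calc (d : ℝ) ^ m ≤ (d : ℝ) ^ m *
        ((∏ p ∈ d.primeFactors, (1 - ((p : ℝ) ^ m)⁻¹)) * (Real.pi ^ 2 / 6)) :=
        le_mul_of_one_le_right (by positivity) hzeta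
    _ = Nat.card {v : A // d • v = 0 ∧ ∀ p ∈ d.primeFactors, (d / p) • v ≠ 0} *
        (Real.pi ^ 2 / 6) := by rw [hcard, mul_assoc]
    _ ≤ _ := by gcongr

theorem exists_linearEquiv_apply_eq_smul_single_int {ι : Type*} [Fintype ι] [DecidableEq ι]
    [Nonempty ι] (v : ι → ℤ) :
    ∃ (e : (ι → ℤ) ≃ₗ[ℤ] (ι → ℤ)) (j : ι) (c : ℤ), e v = c • Pi.single j 1 := by
  obtain ⟨k, S⟩ := (ℤ ∙ v).smithNormalForm (Pi.basisFun ℤ ι)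
  have hv : v ∈ ℤ ∙ v := Submodule.mem_span_singleton_self v
  have hk : k ≤ 1 := by
    have h := finrank_span_le_card (R := ℤ) ({v} : Set (ι → ℤ))
    rw [Module.finrank_eq_card_basis S.bN] at h
    simpa using h
  have hsum := congrArg (fun x : (ℤ ∙ v : Submodule ℤ (ι → ℤ)) => (x : ι → ℤ)) (S.bN.sum_repr ⟨v, hv⟩)
  simp only [AddSubmonoidClass.coe_finsetSum, Submodule.coe_smul, S.snf] at hsum
  refine ⟨S.bM.equivFun, ?_⟩
  interval_cases k
  · refine ⟨Classical.arbitrary ι, 0, ?_⟩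
    exact (congrArg S.bM.equivFun hsum.symm).trans (by simp)
  · refine ⟨S.f 0, S.bN.repr ⟨v, hv⟩ 0 * S.a 0, ?_⟩
    have h1 : S.bM.equivFun (S.bM (S.f 0)) = Pi.single (S.f 0) 1 := by
      ext i
      simp [Pi.single_apply, eq_comm]
    refine (congrArg S.bM.equivFun hsum.symm).trans ?_
    rw [Fin.sum_univ_one, map_smul, map_smul, h1, smul_smul]

theorem exists_linearEquiv_apply_eq_smul_single_zmod {ι : Type*} [Fintype ι] [DecidableEq ι]
    {n : ℕ} [NeZero n] (i : ι) (v : ι → ZMod n) :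
    ∃ e : (ι → ZMod n) ≃ₗ[ZMod n] (ι → ZMod n),
      e v = ((n / addOrderOf v : ℕ) : ZMod n) • Pi.single i 1 := by
  have : Nonempty ι := ⟨i⟩
  obtain ⟨e, j, c, hc⟩ := exists_linearEquiv_apply_eq_smul_single_int fun k => ((v k).val : ℤ)
  let P : GL ι ℤ := GeneralLinearGroup.toLin.symm
    ((LinearMap.GeneralLinearGroup.generalLinearEquiv ℤ (ι → ℤ)).symm e)
  have hP : P.val *ᵥ (fun k => ((v k).val : ℤ)) = c • Pi.single j 1 := by
    rw [← hc]
    exact LinearMap.toMatrix'_mulVec _ _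
  let Q : GL ι (ZMod n) := GeneralLinearGroup.map (Int.castRingHom (ZMod n)) P
  have hQ : Q.val *ᵥ v = (c : ZMod n) • Pi.single j 1 := by
    ext k
    have h := congrArg (Int.castRingHom (ZMod n)) (congrFun hP k)
    rw [RingHom.map_mulVec] at h
    have hv : (Int.castRingHom (ZMod n)) ∘ (fun k => ((v k).val : ℤ)) = v := by
      ext k; simp
    rw [hv] at h
    refine h.trans ?_
    by_cases hkj : k = j <;> simp [hkj]
  let f : (ι → ZMod n) ≃ₗ[ZMod n] (ι → ZMod n) :=
    LinearMap.GeneralLinearGroup.generalLinearEquiv _ _ (GeneralLinearGroup.toLin Q)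
  have hf : f v = (c : ZMod n) • Pi.single j 1 := hQ
  obtain ⟨k, hk, u, ⟨u, rfl⟩, hcu⟩ := (c : ZMod n).eq_unit_mul_divisor
  let g := (f.trans (LinearEquiv.funCongrLeft (ZMod n) (ZMod n) (Equiv.swap i j))).trans
    (LinearEquiv.smulOfUnit u⁻¹)
  have hg : g v = (k : ZMod n) • Pi.single i 1 := by
    have h1 : LinearEquiv.funCongrLeft (ZMod n) (ZMod n) (Equiv.swap i j) (Pi.single j 1) =
        Pi.single i 1 := by
      ext l
      simp [LinearMap.funLeft_apply, Pi.single_apply, Equiv.swap_apply_eq_iff]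
    change u⁻¹ • (LinearEquiv.funCongrLeft (ZMod n) (ZMod n) (Equiv.swap i j)) (f v) = _
    rw [hf, map_smul, h1, hcu, Units.smul_def, smul_smul, Units.inv_mul_cancel_left]
  refine ⟨g, ?_⟩
  have hsingle : (k : ZMod n) • Pi.single i (1 : ZMod n) =
      AddMonoidHom.single (fun _ : ι => ZMod n) i (k : ZMod n) := by
    ext l; simp [Pi.single_apply]
  have hord : addOrderOf v = n / k := by
    rw [← addOrderOf_injective g.toAddEquiv.toAddMonoidHom g.injective v]
    change addOrderOf (g v) = _
    rw [hg, hsingle, addOrderOf_injective _ (Pi.single_injective (M := fun _ => ZMod n) i),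
      ZMod.addOrderOf_coe _ (NeZero.ne n), Nat.gcd_eq_right hk]
  rw [hg, hord, Nat.div_div_self hk (NeZero.ne n)]

theorem card_addMonoidHom_zmod_le (n : ℕ) [NeZero n] (F : Type*) [AddCommGroup F] [Finite F] :
    Nat.card (F →+ ZMod n) ≤ Nat.card F := by
  have := Fintype.ofFinite F
  rw [Nat.card_eq_fintype_card (α := F), ← AddChar.card_eq, ← Nat.card_eq_fintype_card]
  refine Nat.card_le_card_of_injective
    (fun f => (ZMod.stdAddChar (N := n)).compAddMonoidHom f) fun f g h => ?_
  ext x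
  exact ZMod.injective_stdAddChar (DFunLike.congr_fun h x)

theorem card_nsmul_eq_zero_zmod {n : ℕ} [NeZero n] {e : ℕ} (he : e ∣ n) :
    Nat.card {r : ZMod n // e • r = 0} = e := by
  have h := IsAddCyclic.card_nsmulAddMonoidHom_ker (G := ZMod n) e
  rw [Nat.card_zmod, Nat.gcd_eq_right he] at h
  exact h

theorem card_nsmul_eq_zero_pi_zmod {n : ℕ} [NeZero n] (m : ℕ) {e : ℕ} (he : e ∣ n) :
    Nat.card {v : Fin m → ZMod n // e • v = 0} = e ^ m := by
  have h : {v : Fin m → ZMod n // e • v = 0} ≃ (Fin m → {r : ZMod n // e • r = 0}) :=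
    (Equiv.subtypeEquivRight fun v => by simp [funext_iff]).trans Equiv.subtypePiEquivPi
  rw [Nat.card_congr h, Nat.card_fun, card_nsmul_eq_zero_zmod he, Nat.card_eq_fintype_card, Fintype.card_fin]

theorem card_le_mul_card_map_dualMap {n : ℕ} [NeZero n] {V ι : Type*} [AddCommGroup V]
    [Module (ZMod n) V] [Finite V] (b : Module.Basis ι (ZMod n) V) (j : ι) {d : ℕ} (hd : d ∣ n)
    (M : Submodule (ZMod n) V) (hM : ∀ x ∈ M, d • x = 0) :
    Nat.card M ≤ d * Nat.card
      ((LinearMap.ker (Module.Dual.eval (ZMod n) V (b j))).map M.subtype.dualMap) := by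
  set F := (LinearMap.ker (Module.Dual.eval (ZMod n) V (b j))).map M.subtype.dualMap
  have : Finite (Module.Dual (ZMod n) M) := DFunLike.finite _
  let ev : M →+ (F →+ ZMod n) :=
    { toFun := fun x =>
        { toFun := fun f => (f : Module.Dual (ZMod n) M) x
          map_zero' := rfl
          map_add' := fun _ _ => rfl }
      map_zero' := by ext f; exact map_zero (f : Module.Dual (ZMod n) M)
      map_add' := fun x y => by ext f; exact map_add (f : Module.Dual (ZMod n) M) x y }
  have hker : Nat.card ev.ker ≤ d := by
    rw [← card_nsmul_eq_zero_zmod hd]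
    refine Nat.card_le_card_of_injective
      (fun x => ⟨b.coord j (x : M).1, by rw [← map_nsmul, hM _ (x : M).2, map_zero]⟩)
      fun x y h => ?_
    have hzero : ∀ x : ev.ker, ∀ i, i ≠ j → b.coord i (x : M).1 = 0 := fun x i hi =>
      DFunLike.congr_fun (AddMonoidHom.mem_ker.1 x.2)
        ⟨M.subtype.dualMap (b.coord i), Submodule.mem_map_of_mem (by simp [hi.symm])⟩
    refine Subtype.ext (Subtype.ext (b.ext_elem fun i => ?_))
    by_cases hi : i = j
    · subst hi
      exact congrArg Subtype.val h
    · exact (hzero x i hi).trans (hzero y i hi).symm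
  calc Nat.card M = Nat.card ev.ker * Nat.card ev.range := by
        rw [← AddSubgroup.index_ker, AddSubgroup.card_mul_index]
    _ ≤ d * Nat.card (F →+ ZMod n) := by
        have : Finite (F →+ ZMod n) := DFunLike.finite _
        exact Nat.mul_le_mul hker (Nat.card_le_card_of_injective _ Subtype.val_injective)
    _ ≤ d * Nat.card F := Nat.mul_le_mul_left _ (card_addMonoidHom_zmod_le n F)

theorem card_orbit_mul_relIndex_stabilizer {G X : Type*} [Group G] [Finite G] [MulAction G X]
    (Γ : Subgroup G) (x : X) :
    Nat.card (MulAction.orbit G x) * Γ.relIndex (MulAction.stabilizer G x) =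
      Γ.index * Nat.card (MulAction.orbit Γ x) := by
  have hG : Nat.card (MulAction.orbit G x) * Nat.card (MulAction.stabilizer G x) = Nat.card G := by
    rw [← Nat.card_prod, Nat.card_congr (MulAction.orbitProdStabilizerEquivGroup G x)]
  have hΓ : Nat.card (MulAction.orbit Γ x) * Nat.card (MulAction.stabilizer Γ x) = Nat.card Γ := by
    rw [← Nat.card_prod, Nat.card_congr (MulAction.orbitProdStabilizerEquivGroup Γ x)]
  have hstab : Nat.card (MulAction.stabilizer Γ x) * Γ.relIndex (MulAction.stabilizer G x) =
      Nat.card (MulAction.stabilizer G x) := by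
    have e : MulAction.stabilizer Γ x ≃ Γ.subgroupOf (MulAction.stabilizer G x) :=
      { toFun := fun g => ⟨⟨g.1.1, g.2⟩, g.1.2⟩
        invFun := fun g => ⟨⟨g.1.1, g.2⟩, g.1.2⟩
        left_inv := fun _ => rfl
        right_inv := fun _ => rfl }
    rw [Nat.card_congr e, Subgroup.relIndex, Subgroup.card_mul_index]
  refine Nat.eq_of_mul_eq_mul_right (Nat.card_pos (α := MulAction.stabilizer Γ x)) ?_
  rw [mul_assoc, mul_comm (Γ.relIndex _), hstab, hG, mul_assoc, hΓ, Γ.index_mul_card]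

theorem apply_eq_of_mem_span_orbit {R V : Type*} [CommRing R] [AddCommGroup V] [Module R V]
    {Γ : Subgroup (V ≃ₗ[R] V)} {w : V} (hcomm : ∀ g ∈ Γ, ∀ h ∈ Γ, g (h w) = h (g w))
    {g : V ≃ₗ[R] V} (hg : g ∈ Γ) (hgw : g w = w) {x : V}
    (hx : x ∈ Submodule.span R (MulAction.orbit Γ w)) : g x = x := by
  induction hx using Submodule.span_induction with
  | mem x hx =>
    obtain ⟨h, rfl⟩ := hx
    change g (h.1 w) = h.1 w
    rw [hcomm g hg h.1 h.2, hgw]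
  | zero => exact map_zero g
  | add x y _ _ hx hy => rw [map_add, hx, hy]
  | smul a x _ hx => rw [map_smul, hx]

theorem card_map_dualMap_le_relIndex_stabilizer {R V ι : Type*} [CommRing R] [AddCommGroup V]
    [Module R V] [Finite V] (b : Module.Basis ι R V) (j : ι) (c : R) (Γ : Subgroup (V ≃ₗ[R] V))
    (hcomm : ∀ g ∈ Γ, ∀ h ∈ Γ, g (h (c • b j)) = h (g (c • b j))) :
    Nat.card ((LinearMap.ker (Module.Dual.eval R V (b j))).map
        (Submodule.span R (MulAction.orbit Γ (c • b j))).subtype.dualMap) ≤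
      Γ.relIndex (MulAction.stabilizer (V ≃ₗ[R] V) (c • b j)) := by
  have : Finite (V ≃ₗ[R] V) := DFunLike.finite _
  set S := MulAction.stabilizer (V ≃ₗ[R] V) (c • b j)
  set M := Submodule.span R (MulAction.orbit Γ (c • b j))
  choose φ hφ hφM using fun f : (LinearMap.ker (Module.Dual.eval R V (b j))).map
    M.subtype.dualMap => f.2
  have hφ0 : ∀ f, φ f (b j) = 0 := hφ
  let τ : _ → S := fun f => ⟨LinearEquiv.transvection (hφ0 f), by
    change LinearEquiv.transvection (hφ0 f) (c • b j) = c • b j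
    rw [LinearEquiv.transvection.apply, map_smul, hφ0, smul_zero, zero_smul, add_zero]⟩
  refine Nat.card_le_card_of_injective (β := S ⧸ Γ.subgroupOf S)
    (fun f => QuotientGroup.mk (τ f)) fun f f' h => ?_
  have hmem : (τ f)⁻¹ * τ f' ∈ Γ.subgroupOf S := QuotientGroup.eq.1 h
  have hfix : ∀ x ∈ M, (τ f).1 x = (τ f').1 x := fun x hx => by
    have h1 := apply_eq_of_mem_span_orbit hcomm (Subgroup.mem_subgroupOf.1 hmem)
      ((τ f)⁻¹ * τ f').2 hx
    have h2 : (τ f).1.symm ((τ f').1 x) = x := h1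
    rw [LinearEquiv.symm_apply_eq] at h2
    exact h2.symm
  refine Subtype.ext (LinearMap.ext fun x => ?_)
  rw [← hφM f, ← hφM f']
  have h3 := hfix x x.2
  change LinearEquiv.transvection (hφ0 f) x.1 = LinearEquiv.transvection (hφ0 f') x.1 at h3
  rw [LinearEquiv.transvection.apply, LinearEquiv.transvection.apply, add_right_inj] at h3
  simpa using congrArg (b.coord j) h3

theorem card_addOrderOf_eq_le_index_mul {n m : ℕ} [NeZero n] (j : Fin m)
    (Γ : Subgroup ((Fin m → ZMod n) ≃ₗ[ZMod n] (Fin m → ZMod n)))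
    (W : Submodule (ZMod n) (Fin m → ZMod n)) (hinv : ∀ g ∈ Γ, ∀ w ∈ W, g w ∈ W)
    (hcomm : ∀ g ∈ Γ, ∀ h ∈ Γ, ∀ w ∈ W, g (h w) = h (g w)) {w : Fin m → ZMod n} (hw : w ∈ W)
    (hW : ∀ x ∈ W, addOrderOf w • x = 0) :
    Nat.card {v : Fin m → ZMod n // addOrderOf v = addOrderOf w} ≤ Γ.index * addOrderOf w := by
  have : Finite ((Fin m → ZMod n) ≃ₗ[ZMod n] (Fin m → ZMod n)) := DFunLike.finite _
  obtain ⟨e, he⟩ := exists_linearEquiv_apply_eq_smul_single_zmod j w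
  set c : ZMod n := ((n / addOrderOf w : ℕ) : ZMod n)
  let b := (Pi.basisFun (ZMod n) (Fin m)).map e.symm
  have hb : w = c • b j := by
    rw [Module.Basis.map_apply, Pi.basisFun_apply, ← map_smul, ← he, e.symm_apply_apply]
  have hdn : addOrderOf w ∣ n := addOrderOf_dvd_of_nsmul_eq_zero (by ext; simp)
  set M := Submodule.span (ZMod n) (MulAction.orbit Γ w)
  have hMW : M ≤ W := Submodule.span_le.2 (by rintro _ ⟨g, rfl⟩; exact hinv g.1 g.2 w hw)
  have hcardM := card_le_mul_card_map_dualMap b j hdn M fun x hx => hW x (hMW hx)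
  have hindex : Nat.card ((LinearMap.ker (Module.Dual.eval (ZMod n) (Fin m → ZMod n) (b j))).map
      M.subtype.dualMap) ≤ Γ.relIndex (MulAction.stabilizer _ w) := by
    have h := card_map_dualMap_le_relIndex_stabilizer b j c Γ fun g hg h hh =>
      hb ▸ hcomm g hg h hh w hw
    rwa [← hb] at h
  have horbit : Nat.card {v : Fin m → ZMod n // addOrderOf v = addOrderOf w} ≤
      Nat.card (MulAction.orbit ((Fin m → ZMod n) ≃ₗ[ZMod n] (Fin m → ZMod n)) w) := by
    refine Nat.card_mono (Set.toFinite _) fun v (hv : addOrderOf v = addOrderOf w) => ?_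
    obtain ⟨f, hf⟩ := exists_linearEquiv_apply_eq_smul_single_zmod j v
    refine ⟨f⁻¹ * e, ?_⟩
    change f.symm (e w) = v
    rw [he, LinearEquiv.symm_apply_eq, hf, hv]
  have horbitM : Nat.card (MulAction.orbit Γ w) ≤ Nat.card M :=
    Nat.card_mono (Set.toFinite _) Submodule.subset_span
  have : Finite (Module.Dual (ZMod n) M) := DFunLike.finite _
  set F := (LinearMap.ker (Module.Dual.eval (ZMod n) (Fin m → ZMod n) (b j))).map
    M.subtype.dualMap
  refine Nat.le_of_mul_le_mul_right ?_ (Nat.card_pos (α := F))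
  calc _ ≤ _ := Nat.mul_le_mul horbit hindex
    _ = Γ.index * Nat.card (MulAction.orbit Γ w) := card_orbit_mul_relIndex_stabilizer Γ w
    _ ≤ Γ.index * (addOrderOf w * Nat.card F) := Nat.mul_le_mul_left _ (horbitM.trans hcardM)
    _ = _ := (mul_assoc _ _ _).symm

theorem pow_le_rpow_mul_rpow_of_pow_le {D I z : ℝ} {m : ℕ} (hm : 1 < m) (hD : 1 ≤ D)
    (hI : 1 ≤ I) (hz : 1 ≤ z) (h : D ^ m ≤ I * D * z) :
    D ^ m ≤ I ^ ((1 : ℝ) + (m : ℝ) / 2) * z ^ (((m : ℝ) - 1) * (1 + (m : ℝ) / 2)) := by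
  have hm2 : (2 : ℝ) ≤ m := by exact_mod_cast hm
  have hIz : D ^ ((m : ℝ) - 1) ≤ I * z := by
    rw [Real.rpow_sub_one (by positivity), Real.rpow_natCast, div_le_iff₀ (by positivity)]
    linarith
  calc D ^ m = D ^ (m : ℝ) := (Real.rpow_natCast D m).symm
    _ ≤ D ^ (((m : ℝ) - 1) * (1 + (m : ℝ) / 2)) :=
        Real.rpow_le_rpow_of_exponent_le hD (by nlinarith)
    _ = (D ^ ((m : ℝ) - 1)) ^ (1 + (m : ℝ) / 2) := Real.rpow_mul (by positivity) _ _
    _ ≤ (I * z) ^ (1 + (m : ℝ) / 2) := by gcongr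
    _ = I ^ (1 + (m : ℝ) / 2) * z ^ (1 + (m : ℝ) / 2) :=
        Real.mul_rpow (by positivity) (by positivity)
    _ ≤ _ := by
        gcongr
        nlinarith

theorem card_addOrderOf_eq_le_index_mul_of_GL {n m : ℕ} [NeZero n] (j : Fin m)
    (Γ : Subgroup (GL (Fin m) (ZMod n))) (W : Submodule (ZMod n) (Fin m → ZMod n))
    (hinv : ∀ g ∈ Γ, ∀ w ∈ W, g.val *ᵥ w ∈ W)
    (habel : ∀ A ∈ Γ, ∀ B ∈ Γ, ∀ w ∈ W, (A * B).val *ᵥ w = (B * A).val *ᵥ w)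
    {w : Fin m → ZMod n} (hw : w ∈ W) (hW : ∀ x ∈ W, addOrderOf w • x = 0) :
    Nat.card {v : Fin m → ZMod n // addOrderOf v = addOrderOf w} ≤ Γ.index * addOrderOf w := by
  let E : GL (Fin m) (ZMod n) ≃* ((Fin m → ZMod n) ≃ₗ[ZMod n] (Fin m → ZMod n)) :=
    GeneralLinearGroup.toLin.trans (LinearMap.GeneralLinearGroup.generalLinearEquiv _ _)
  have hE : ∀ g x, E g x = g.val *ᵥ x := fun _ _ => rfl
  rw [← Subgroup.index_map_equiv Γ E]
  refine card_addOrderOf_eq_le_index_mul j _ W ?_ ?_ hw hW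
  · rintro _ ⟨g, hg, rfl⟩ x hx
    exact hinv g hg x hx
  · rintro _ ⟨g, hg, rfl⟩ _ ⟨h, hh, rfl⟩ x hx
    simpa [hE, Matrix.mulVec_mulVec] using habel g hg h hh x hx

/-- **Rosen–Silverman linear algebra estimate, general dimension.**
If `Γ ≤ GL_m(ℤ/nℤ)` acts abelianly on a `Γ`-invariant submodule `W` of `(ℤ/nℤ)^m`,
then `|W| ≤ I(Γ)^(1 + m/2) · ζ(2)^((m-1)(1 + m/2))`, where `I(Γ)` is the index of `Γ`
and `ζ(2) = π²/6`. -/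
theorem card_le_of_abelian_action_GL
    (n m : ℕ) (hn : 1 < n) (hm : 1 < m)
    (Γ : Subgroup (GL (Fin m) (ZMod n)))
    (W : Submodule (ZMod n) (Fin m → ZMod n))
    (hinv : ∀ g ∈ Γ, ∀ w ∈ W, (g : GL (Fin m) (ZMod n)).val.mulVec w ∈ W)
    (habel : ∀ A ∈ Γ, ∀ B ∈ Γ, ∀ w ∈ W,
      ((A * B : GL (Fin m) (ZMod n)).val).mulVec w =
      ((B * A : GL (Fin m) (ZMod n)).val).mulVec w) :
    (Nat.card W : ℝ) ≤
      (Γ.index : ℝ) ^ ((1 : ℝ) + (m : ℝ) / 2) *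
        (Real.pi ^ 2 / 6) ^ (((m : ℝ) - 1) * (1 + (m : ℝ) / 2)) := by
  have : NeZero n := ⟨by omega⟩
  obtain ⟨w, hw⟩ := AddMonoid.exists_addOrderOf_eq_exponent
    (AddMonoid.ExponentExists.of_finite (G := W))
  have hord : addOrderOf (w : Fin m → ZMod n) = AddMonoid.exponent W := by
    rw [← hw]
    exact addOrderOf_injective W.toAddSubgroup.subtype Subtype.val_injective w
  have hW : ∀ x ∈ W, addOrderOf (w : Fin m → ZMod n) • x = 0 := fun x hx => by
    rw [hord]
    exact congrArg Subtype.val (AddMonoid.exponent_nsmul_eq_zero (⟨x, hx⟩ : W))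
  have hdn : addOrderOf (w : Fin m → ZMod n) ∣ n :=
    addOrderOf_dvd_of_nsmul_eq_zero (by ext; simp)
  have hindex := card_addOrderOf_eq_le_index_mul_of_GL ⟨0, by omega⟩ Γ W hinv habel w.2 hW
  have hcount := pow_le_card_addOrderOf_eq_mul_zeta_two (A := Fin m → ZMod n) (NeZero.ne n)
    (Nat.succ_le_of_lt hm) (fun e he => card_nsmul_eq_zero_pi_zmod m he) hdn
  set d := addOrderOf (w : Fin m → ZMod n)
  have hcardW : Nat.card W ≤ d ^ m := by
    rw [← card_nsmul_eq_zero_pi_zmod m hdn]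
    exact Nat.card_mono (Set.toFinite _) hW
  have hd : 0 < d := Nat.pos_of_dvd_of_pos hdn (by omega)
  have hI : 0 < Γ.index := Nat.pos_of_ne_zero Subgroup.FiniteIndex.index_ne_zero
  refine le_trans (by exact_mod_cast hcardW) (pow_le_rpow_mul_rpow_of_pow_le (D := d) hm
    (by exact_mod_cast hd) (by exact_mod_cast hI) ?_ (hcount.trans ?_))
  · nlinarith [Real.pi_gt_three]
  · gcongr
    exact_mod_cast hindex
end

section
/- Let n > 1 and m ≥ 1 be integers, let V = (ZMod n)^(2m), and let Γ be a subgroup of the symplectic group Sp(2m, ZMod n) (matrices M over ZMod n with Mᵀ·Ω·M = Ω, where Ω is the block matrix [[0, I_m], [-I_m, 0]]), acting naturally on V. Suppose W is a ZMod n-submodule of V that is Γ-invariant and on which Γ acts abelianly, i.e. (A * B) • w = (B * A) • w for all A, B ∈ Γ and all w ∈ W. Let I(Γ) denote the index of Γ in Sp(2m, ZMod n). Then |W| ≤ I(Γ)^(2 + 2m) · (π²/6)^(2 + 2m). -/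
open Matrix

/-- The standard symplectic form matrix Ω = [[0, I], [-I, 0]]. -/
def Omega (m : ℕ) (R : Type*) [CommRing R] :
    Matrix (Fin m ⊕ Fin m) (Fin m ⊕ Fin m) R :=
  Matrix.fromBlocks 0 1 (-1) 0

/-- The symplectic group `Sp(2m, R)`: matrices `M` with `Mᵀ * Ω * M = Ω`,
as a subgroup of the general linear group. -/
def Sp (m : ℕ) (R : Type*) [CommRing R] : Subgroup (GL (Fin m ⊕ Fin m) R) where
  carrier := {M | (M.val)ᵀ * Omega m R * M.val = Omega m R}
  one_mem' := by simp
  mul_mem' := by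
    intro a b ha hb
    simp only [Set.mem_setOf_eq, Units.val_mul, Matrix.transpose_mul] at ha hb ⊢
    calc (b.val)ᵀ * (a.val)ᵀ * Omega m R * (a.val * b.val)
        = (b.val)ᵀ * ((a.val)ᵀ * Omega m R * a.val * b.val) := by
          simp only [Matrix.mul_assoc]
      _ = Omega m R := by rw [ha, ← Matrix.mul_assoc]; exact hb
  inv_mem' := by
    intro a ha
    simp only [Set.mem_setOf_eq] at ha ⊢
    have h1 : a.val * (a⁻¹).val = 1 := by
      rw [← Units.val_mul, mul_inv_cancel, Units.val_one]
    calc ((a⁻¹).val)ᵀ * Omega m R * (a⁻¹).val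
        = ((a⁻¹).val)ᵀ * ((a.val)ᵀ * Omega m R * a.val) * (a⁻¹).val := by rw [ha]
      _ = (a.val * (a⁻¹).val)ᵀ * Omega m R * (a.val * (a⁻¹).val) := by
          simp only [Matrix.transpose_mul, Matrix.mul_assoc]
      _ = Omega m R := by rw [h1]; simp

/-- The additive group of symmetric matrices. -/
def symmMat (m : ℕ) (R : Type*) [CommRing R] : AddSubgroup (Matrix (Fin m) (Fin m) R) where
  carrier := {S | Sᵀ = S}
  zero_mem' := by simp
  add_mem' := by
    intro a b ha hb
    simp only [Set.mem_ofPred_eq, Matrix.transpose_add] at ha hb ⊢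
    rw [ha, hb]
  neg_mem' := by
    intro a ha
    simp only [Set.mem_ofPred_eq, Matrix.transpose_neg] at ha ⊢
    rw [ha]

section Unipotent

variable {m : ℕ} {R : Type*} [CommRing R]

/-- The embedding `S ↦ [[1, S], [0, 1]]` of the symmetric matrices into the symplectic group. -/
def upperUnipotent (m : ℕ) (R : Type*) [CommRing R] :
    Multiplicative (symmMat m R) →* Sp m R where
  toFun S := ⟨⟨Matrix.fromBlocks 1 S.toAdd.1 0 1, Matrix.fromBlocks 1 (-S.toAdd.1) 0 1,
      by simp [Matrix.fromBlocks_multiply], by simp [Matrix.fromBlocks_multiply]⟩, by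
    have h : (S.toAdd.1)ᵀ = S.toAdd.1 := S.toAdd.2
    change _ * _ * _ = _
    simp [Omega, Matrix.fromBlocks_multiply, Matrix.fromBlocks_transpose, h]⟩
  map_one' := by
    ext1; ext1
    simp
  map_mul' S T := by
    ext1; ext1
    simp [Matrix.fromBlocks_multiply, add_comm]

/-- The embedding `S ↦ [[1, 0], [S, 1]]` of the symmetric matrices into the symplectic group. -/
def lowerUnipotent (m : ℕ) (R : Type*) [CommRing R] :
    Multiplicative (symmMat m R) →* Sp m R where
  toFun S := ⟨⟨Matrix.fromBlocks 1 0 S.toAdd.1 1, Matrix.fromBlocks 1 0 (-S.toAdd.1) 1,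
      by simp [Matrix.fromBlocks_multiply], by simp [Matrix.fromBlocks_multiply]⟩, by
    have h : (S.toAdd.1)ᵀ = S.toAdd.1 := S.toAdd.2
    change _ * _ * _ = _
    simp [Omega, Matrix.fromBlocks_multiply, Matrix.fromBlocks_transpose, h]⟩
  map_one' := by
    ext1; ext1
    simp
  map_mul' S T := by
    ext1; ext1
    simp [Matrix.fromBlocks_multiply, add_comm]

theorem mulVec_mulVec_eq_zero_of_unipotent_commute (S T : symmMat m R)
    (w : Fin m ⊕ Fin m → R)
    (h : ((upperUnipotent m R (.ofAdd S) * lowerUnipotent m R (.ofAdd T) : Sp m R) :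
        GL (Fin m ⊕ Fin m) R).val.mulVec w =
      ((lowerUnipotent m R (.ofAdd T) * upperUnipotent m R (.ofAdd S) : Sp m R) :
        GL (Fin m ⊕ Fin m) R).val.mulVec w) :
    S.1 *ᵥ (T.1 *ᵥ (w ∘ Sum.inl)) = 0 ∧ T.1 *ᵥ (S.1 *ᵥ (w ∘ Sum.inr)) = 0 := by
  simp only [upperUnipotent, lowerUnipotent, MonoidHom.coe_mk, OneHom.coe_mk, toAdd_ofAdd,
    Subgroup.coe_mul, Units.val_mul, Matrix.fromBlocks_multiply, Matrix.fromBlocks_mulVec] at h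
  have h1 := (Sum.elim_eq_iff.mp h).1
  have h2 := (Sum.elim_eq_iff.mp h).2
  simp only [Matrix.one_mul, Matrix.mul_one, Matrix.mul_zero, add_zero, zero_add,
    Matrix.add_mulVec, Matrix.one_mulVec] at h1 h2
  simp only [Matrix.mulVec_mulVec]
  constructor
  · simpa [add_assoc] using h1
  · simpa [add_assoc, add_comm, add_left_comm] using h2.symm

end Unipotent

/-- The vectors killed by all matrices in a set `L` of symmetric matrices. -/
def commonKer {m : ℕ} {R : Type*} [CommRing R] (L : AddSubgroup (symmMat m R)) :
    AddSubgroup (Fin m → R) where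
  carrier := {z | ∀ S ∈ L, S.1 *ᵥ z = 0}
  zero_mem' := by simp
  add_mem' := by
    intro a b ha hb S hS
    rw [Matrix.mulVec_add, ha S hS, hb S hS, add_zero]
  neg_mem' := by
    intro a ha S hS
    rw [Matrix.mulVec_neg, ha S hS, neg_zero]

/-- The vectors killed by all products `S * T` with `S ∈ L` and `T ∈ L'`. -/
def commonKerMul {m : ℕ} {R : Type*} [CommRing R] (L L' : AddSubgroup (symmMat m R)) :
    AddSubgroup (Fin m → R) where
  carrier := {z | ∀ T ∈ L', T.1 *ᵥ z ∈ commonKer L}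
  zero_mem' := by
    intro T _
    simp
  add_mem' := by
    intro a b ha hb T hT
    rw [Matrix.mulVec_add]
    exact add_mem (ha T hT) (hb T hT)
  neg_mem' := by
    intro a ha T hT
    rw [Matrix.mulVec_neg]
    exact neg_mem (ha T hT)

theorem exists_symm_mulVec_eq {m : ℕ} {R : Type*} [CommRing R] (a z' v : Fin m → R) (g : R)
    (hg : a ⬝ᵥ (g • z') = g) : ∃ S ∈ symmMat m R, S *ᵥ (g • z') = g • v := by
  refine ⟨vecMulVec v a + vecMulVec a v - (v ⬝ᵥ z') • vecMulVec a a, ?_, ?_⟩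
  · change _ᵀ = _
    simp [Matrix.transpose_vecMulVec, add_comm]
  · ext i
    simp only [Matrix.sub_mulVec, Matrix.add_mulVec, Matrix.smul_mulVec,
      Matrix.vecMulVec_mulVec, hg]
    simp
    ring

section ZMod

variable {n m : ℕ} [NeZero n]

theorem card_commonKer_le (L : AddSubgroup (symmMat m (ZMod n))) :
    Nat.card (commonKer L) ≤ L.index := by
  let φ : (z : commonKer L) → symmMat m (ZMod n) ⧸ L →+ ZMod n := fun z =>
    QuotientAddGroup.lift L
      (AddMonoidHom.mk' (fun S : symmMat m (ZMod n) => ∑ i, (S.1 *ᵥ z.1) i) fun S T => by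
        simp [Matrix.add_mulVec, Finset.sum_add_distrib])
      fun S hS => by simp [z.2 S hS]
  have : Fintype (symmMat m (ZMod n) ⧸ L) := Fintype.ofFinite _
  calc Nat.card (commonKer L) ≤ Nat.card (AddChar (symmMat m (ZMod n) ⧸ L) ℂ) := by
        refine Nat.card_le_card_of_injective
          (fun z => ZMod.stdAddChar.compAddMonoidHom (φ z)) fun z w h => ?_
        have h' : ∀ q, φ z q = φ w q := fun q =>
          ZMod.injective_stdAddChar (DFunLike.congr_fun h q)
        ext j
        have := h' (QuotientAddGroup.mk
          ⟨Matrix.diagonal (Pi.single j 1), Matrix.diagonal_transpose _⟩)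
        simpa [φ, Matrix.mulVec_diagonal, Pi.single_apply] using this
    _ = Nat.card (symmMat m (ZMod n) ⧸ L) := by
        rw [Nat.card_eq_fintype_card, AddChar.card_eq, Nat.card_eq_fintype_card]
    _ = L.index := rfl

theorem pow_addOrderOf_le (L : AddSubgroup (symmMat m (ZMod n))) (z : Fin m → ZMod n)
    (hz : z ∈ commonKer L) : addOrderOf z ^ m ≤ L.index := by
  have : IsPrincipalIdealRing (ZMod n) :=
    IsPrincipalIdealRing.of_surjective (Int.castRingHom (ZMod n)) ZMod.intCast_surjective
  obtain ⟨g, hg⟩ := (IsPrincipalIdealRing.principal (Ideal.span (Set.range z))).principal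
  have hgm : g ∈ Ideal.span (Set.range z) := hg ▸ Submodule.mem_span_singleton_self g
  obtain ⟨a, ha⟩ := Ideal.mem_span_range_iff_exists_fun.mp hgm
  have hz' : ∀ i, ∃ c, c * g = z i := fun i => by
    have : z i ∈ Ideal.span (Set.range z) := Ideal.subset_span ⟨i, rfl⟩
    rw [hg] at this
    exact Submodule.mem_span_singleton.mp this
  choose z' hz' using hz'
  obtain rfl : g • z' = z := by
    ext i
    simp [← hz' i, mul_comm]
  have key := fun v => exists_symm_mulVec_eq a z' v g ha
  choose S hS hSv using key
  have hord : addOrderOf (g • z') ≤ addOrderOf g := by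
    refine Nat.le_of_dvd (addOrderOf_pos g) (addOrderOf_dvd_of_nsmul_eq_zero ?_)
    rw [← smul_assoc, addOrderOf_nsmul_eq_zero, zero_smul]
  have hmul : ∀ c : Fin m → AddSubgroup.zmultiples g, ∃ v : Fin m → ZMod n,
      g • v = fun i => (c i : ZMod n) := fun c => by
    choose v hv using fun i => AddSubgroup.mem_zmultiples_iff.mp (c i).2
    refine ⟨fun i => v i, ?_⟩
    ext i
    simp [← hv i, mul_comm]
  choose v hv using hmul
  calc addOrderOf (g • z') ^ m ≤ addOrderOf g ^ m := Nat.pow_le_pow_left hord m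
    _ = Nat.card (Fin m → AddSubgroup.zmultiples g) := by
      rw [Nat.card_fun, Nat.card_zmultiples, Nat.card_fin]
    _ ≤ Nat.card (symmMat m (ZMod n) ⧸ L) := by
      refine Nat.card_le_card_of_injective
        (fun c => QuotientAddGroup.mk (⟨S (v c), hS _⟩ : symmMat m (ZMod n))) ?_
      intro c d hcd
      have := hz _ (QuotientAddGroup.eq.mp hcd)
      simp only [AddSubgroup.coe_add, NegMemClass.coe_neg, Matrix.add_mulVec, Matrix.neg_mulVec,
        hSv, hv] at this
      ext i
      have := congrFun this i
      simp only [Pi.add_apply, Pi.neg_apply, Pi.zero_apply] at this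
      exact neg_add_eq_zero.mp this
    _ = L.index := rfl

theorem card_torsion_le (r : ℕ) (hr : 0 < r) :
    Nat.card (nsmulAddMonoidHom (α := Fin m → ZMod n) r).ker ≤ r ^ m := by
  calc Nat.card (nsmulAddMonoidHom (α := Fin m → ZMod n) r).ker
      ≤ Nat.card (Fin m → {a : ZMod n // r • a = 0}) := by
        refine Nat.card_le_card_of_injective (fun x i => ⟨x.1 i, congrFun x.2 i⟩) fun x y h => ?_
        ext i
        exact congrArg Subtype.val (congrFun h i)
    _ = Nat.card {a : ZMod n // r • a = 0} ^ m := by simp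
    _ ≤ r ^ m := by
        refine Nat.pow_le_pow_left ?_ m
        rw [Nat.card_eq_fintype_card, Fintype.card_subtype]
        exact IsAddCyclic.card_nsmul_eq_zero_le hr

theorem card_commonKerMul_le (L L' : AddSubgroup (symmMat m (ZMod n))) :
    Nat.card (commonKerMul L L') ≤ L.index * L'.index := by
  obtain ⟨z, hz⟩ := AddMonoid.exists_addOrderOf_eq_exponent
    (AddMonoid.ExponentExists.of_finite (G := commonKer L))
  have hr : ∀ y ∈ commonKer L, addOrderOf z.1 • y = 0 := fun y hy => by
    have := AddMonoid.exponent_nsmul_eq_zero (⟨y, hy⟩ : commonKer L)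
    rw [← hz, ← AddSubgroup.addOrderOf_coe] at this
    exact congrArg Subtype.val this
  set r := addOrderOf z.1
  have hr0 : 0 < r := addOrderOf_pos z.1
  let f : commonKerMul L L' →+ commonKer L' :=
    ((nsmulAddMonoidHom r).comp (commonKerMul L L').subtype).codRestrict (commonKer L')
      fun x T hT => by
        exact (Matrix.mulVec_smul T.1 r x.1).trans (hr _ (x.2 T hT))
  have hker : Nat.card f.ker ≤ r ^ m := by
    refine le_trans ?_ (card_torsion_le (n := n) r hr0)
    refine Nat.card_le_card_of_injective
      (fun x => ⟨x.1.1, congrArg Subtype.val (AddMonoidHom.mem_ker.mp x.2)⟩) fun x y h => ?_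
    exact Subtype.ext (Subtype.ext (Subtype.mk.inj h))
  calc Nat.card (commonKerMul L L') = Nat.card f.ker * f.ker.index :=
        (AddSubgroup.card_mul_index f.ker).symm
    _ = Nat.card f.ker * Nat.card f.range := by rw [AddSubgroup.index_ker]
    _ ≤ L.index * L'.index := Nat.mul_le_mul (hker.trans (pow_addOrderOf_le L z.1 z.2))
        ((AddSubgroup.card_le_card_addGroup _).trans (card_commonKer_le L'))

end ZMod

theorem index_comap_le {G H : Type*} [Group G] [Group H] [Finite H] (f : G →* H)
    (Γ : Subgroup H) : (Γ.comap f).index ≤ Γ.index := by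
  rw [Subgroup.index_comap, ← Subgroup.relIndex_top_right]
  refine Subgroup.relIndex_le_of_le_right le_top ?_
  rw [Subgroup.relIndex_top_right]
  exact Subgroup.index_ne_zero_of_finite

/-- **Rosen–Silverman type estimate, symplectic case.**
If `Γ ≤ Sp(2m, ℤ/nℤ)` acts abelianly on a `Γ`-invariant submodule `W` of `(ℤ/nℤ)^(2m)`,
then `|W| ≤ I(Γ)^(2 + 2m) · ζ(2)^(2 + 2m)`, where `I(Γ)` is the index of `Γ` in the
symplectic group and `ζ(2) = π²/6`. -/
theorem card_le_of_abelian_action_Sp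
    (n m : ℕ) (hn : 1 < n) (hm : 1 ≤ m)
    (Γ : Subgroup (Sp m (ZMod n)))
    (W : Submodule (ZMod n) (Fin m ⊕ Fin m → ZMod n))
    (hinv : ∀ g ∈ Γ, ∀ w ∈ W, (g : Sp m (ZMod n)).val.val.mulVec w ∈ W)
    (habel : ∀ A ∈ Γ, ∀ B ∈ Γ, ∀ w ∈ W,
      ((A * B : Sp m (ZMod n)) : GL (Fin m ⊕ Fin m) (ZMod n)).val.mulVec w =
      ((B * A : Sp m (ZMod n)) : GL (Fin m ⊕ Fin m) (ZMod n)).val.mulVec w) :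
    (Nat.card W : ℝ) ≤
      (Γ.index : ℝ) ^ ((2 : ℝ) + 2 * (m : ℝ)) *
        (Real.pi ^ 2 / 6) ^ ((2 : ℝ) + 2 * (m : ℝ)) := by
  have : NeZero n := ⟨by omega⟩
  let L : AddSubgroup (symmMat m (ZMod n)) :=
    Subgroup.toAddSubgroup' (Γ.comap (upperUnipotent m (ZMod n)))
  let L' : AddSubgroup (symmMat m (ZMod n)) :=
    Subgroup.toAddSubgroup' (Γ.comap (lowerUnipotent m (ZMod n)))
  have hL : L.index ≤ Γ.index := index_comap_le (upperUnipotent m (ZMod n)) Γ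
  have hL' : L'.index ≤ Γ.index := index_comap_le (lowerUnipotent m (ZMod n)) Γ
  have hW : ∀ w ∈ W, w ∘ Sum.inl ∈ commonKerMul L L' ∧ w ∘ Sum.inr ∈ commonKerMul L' L := by
    intro w hw
    have h : ∀ S ∈ L, ∀ T ∈ L', _ := fun S hS T hT =>
      mulVec_mulVec_eq_zero_of_unipotent_commute S T w (habel _ hS _ hT w hw)
    exact ⟨fun T hT S hS => (h S hS T hT).1, fun S hS T hT => (h S hS T hT).2⟩
  have hcard : Nat.card W ≤ Γ.index ^ 4 := by
    calc Nat.card W ≤ Nat.card (commonKerMul L L' × commonKerMul L' L) := by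
          refine Nat.card_le_card_of_injective
            (fun w => (⟨_, (hW w.1 w.2).1⟩, ⟨_, (hW w.1 w.2).2⟩)) fun w w' h => ?_
          simp only [Prod.mk.injEq, Subtype.mk.injEq] at h
          ext (i | i)
          · exact congrFun h.1 i
          · exact congrFun h.2 i
      _ = Nat.card (commonKerMul L L') * Nat.card (commonKerMul L' L) := Nat.card_prod _ _
      _ ≤ (L.index * L'.index) * (L'.index * L.index) :=
          Nat.mul_le_mul (card_commonKerMul_le L L') (card_commonKerMul_le L' L)
      _ ≤ (Γ.index * Γ.index) * (Γ.index * Γ.index) := by gcongr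
      _ = Γ.index ^ 4 := by ring
  have hI : (1 : ℝ) ≤ Γ.index := by
    exact_mod_cast Nat.one_le_iff_ne_zero.mpr Subgroup.index_ne_zero_of_finite
  have hm' : (1 : ℝ) ≤ m := by exact_mod_cast hm
  have hζ : (1 : ℝ) ≤ Real.pi ^ 2 / 6 := by nlinarith [Real.pi_gt_three]
  calc (Nat.card W : ℝ) ≤ (Γ.index : ℝ) ^ 4 := by exact_mod_cast hcard
    _ = (Γ.index : ℝ) ^ (4 : ℝ) := by norm_cast
    _ ≤ (Γ.index : ℝ) ^ ((2 : ℝ) + 2 * (m : ℝ)) :=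
        Real.rpow_le_rpow_of_exponent_le hI (by linarith)
    _ ≤ _ := le_mul_of_one_le_right (by positivity)
        (Real.one_le_rpow hζ (by positivity))
end

section
/- Let l be a prime, e ≥ 1 and m ≥ 2 integers, and set n = l^e. Let Γ be a subgroup of GL_m(ZMod n), and let W be a Γ-invariant ZMod n-submodule of (ZMod n)^m on which Γ acts abelianly. Let I(Γ) be the index of Γ in GL_m(ZMod n). Then I(Γ)^(1 + m/2) ≥ |W| · (∏_{k=2}^{m} (1 - l^{-k}))^(1 + m/2). -/
open Matrix

/-- In a finite commutative ring whose elements are totally ordered by divisibility, a nonempty set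
contains an element dividing all the others. -/
theorem exists_mem_forall_dvd_of_dvd_total {R : Type*} [CommRing R] [Finite R]
    (htot : ∀ x y : R, x ∣ y ∨ y ∣ x) (s : Set R) (hs : s.Nonempty) :
    ∃ x ∈ s, ∀ y ∈ s, x ∣ y := by
  obtain ⟨x, hx, hmax⟩ :=
    Set.exists_max_image s (fun x => Nat.card (Ideal.span {x})) s.toFinite hs
  refine ⟨x, hx, fun y hy => (htot x y).elim id fun hyx => ?_⟩
  have hle : Ideal.span {x} ≤ Ideal.span {y} := Ideal.span_singleton_le_span_singleton.2 hyx
  have heq : (Ideal.span {x} : Set R) = Ideal.span {y} :=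
    Set.eq_of_subset_of_ncard_le hle (hmax y hy) (Set.toFinite _)
  exact Ideal.mem_span_singleton.1 (heq.ge (Ideal.mem_span_singleton_self y))

theorem ZMod.dvd_total_of_prime_pow {l : ℕ} (hl : l.Prime) (e : ℕ) (x y : ZMod (l ^ e)) :
    x ∣ y ∨ y ∣ x := by
  have : NeZero (l ^ e) := ⟨pow_ne_zero _ hl.ne_zero⟩
  have key : ∀ x : ZMod (l ^ e), x = 0 ∨ ∃ k : ℕ, Associated ((l : ZMod (l ^ e)) ^ k) x := by
    intro x
    by_cases hx : x = 0
    · exact Or.inl hx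
    obtain ⟨k, c, hc, hk⟩ :=
      Nat.exists_eq_pow_mul_and_not_dvd ((ZMod.val_ne_zero x).2 hx) l hl.ne_one
    have hu : IsUnit (c : ZMod (l ^ e)) :=
      (ZMod.isUnit_iff_coprime _ _).2 (((hl.coprime_iff_not_dvd.2 hc).symm).pow_right e)
    refine Or.inr ⟨k, hu.unit, ?_⟩
    rw [hu.unit_spec, ← ZMod.natCast_zmod_val x, hk]
    push_cast
    rfl
  rcases key x with rfl | ⟨a, ha⟩
  · exact Or.inr (dvd_zero _)
  rcases key y with rfl | ⟨b, hb⟩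
  · exact Or.inl (dvd_zero _)
  rw [← ha.dvd_iff_dvd_left, ← hb.dvd_iff_dvd_right, ← hb.dvd_iff_dvd_left,
    ← ha.dvd_iff_dvd_right]
  exact (le_total a b).imp (pow_dvd_pow _) (pow_dvd_pow _)

/-- A nonzero principal ideal `(x)` of `ℤ/l^e` has at most `(1 - 1/l) |(x)|` generators. -/
theorem ZMod.ncard_generators_mul_le {l : ℕ} (hl : l.Prime) (e : ℕ) {x : ZMod (l ^ e)}
    (hx : x ≠ 0) :
    {y | x ∣ y ∧ y ∣ x}.ncard * l ≤ (l - 1) * Nat.card (Ideal.span {x}) := by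
  have : NeZero (l ^ e) := ⟨pow_ne_zero _ hl.ne_zero⟩
  let f : ZMod (l ^ e) →+ ZMod (l ^ e) := AddMonoidHom.mulLeft (l : ZMod (l ^ e))
  let I : AddSubgroup (ZMod (l ^ e)) := (Ideal.span {x}).toAddSubgroup
  let g : I →+ ZMod (l ^ e) := f.comp I.subtype
  have hker : Nat.card g.ker ≤ l := by
    have h1 := IsAddCyclic.card_nsmul_eq_zero_le (α := ZMod (l ^ e)) hl.pos
    refine le_trans ?_ h1
    rw [← Fintype.card_subtype, ← Nat.card_eq_fintype_card]
    refine Nat.card_le_card_of_injective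
      (fun y : g.ker => (⟨y.1.1, by rw [nsmul_eq_mul]; exact y.2⟩ :
        {a : ZMod (l ^ e) // l • a = 0})) fun y z h => ?_
    exact Subtype.ext (Subtype.ext (congrArg (fun a => a.1) h))
  have hcard : Nat.card g.ker * Nat.card g.range = Nat.card I := by
    rw [← AddSubgroup.index_ker, AddSubgroup.card_mul_index]
  have hsub : {y | x ∣ y ∧ y ∣ x} ∪ (g.range : Set (ZMod (l ^ e))) ⊆ I := by
    rintro y (hy | ⟨⟨z, hz⟩, rfl⟩)
    · exact Ideal.mem_span_singleton.2 hy.1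
    · exact Ideal.mul_mem_left _ _ hz
  have hdisj : Disjoint {y | x ∣ y ∧ y ∣ x} (g.range : Set (ZMod (l ^ e))) := by
    rw [Set.disjoint_left]
    rintro y ⟨-, hy⟩ ⟨⟨z, hz⟩, rfl⟩
    obtain ⟨t, ht⟩ := Ideal.mem_span_singleton.1 hz
    obtain ⟨s, hs⟩ := hy
    have hnil : IsNilpotent ((l : ZMod (l ^ e)) * (t * s)) := by
      refine (Commute.all _ _).isNilpotent_mul_right ⟨e, ?_⟩
      exact_mod_cast ZMod.natCast_self (l ^ e)
    apply hx
    have h0 : (1 - (l : ZMod (l ^ e)) * (t * s)) * x = 0 := by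
      have hs' : x = l * z * s := hs
      rw [ht] at hs'
      linear_combination hs'
    exact (hnil.isUnit_one_sub.mul_right_eq_zero).1 h0
  have hunion := Set.ncard_le_ncard hsub (Set.toFinite _)
  rw [Set.ncard_union_eq hdisj (Set.toFinite _) (Set.toFinite _)] at hunion
  change _ + Nat.card g.range ≤ Nat.card I at hunion
  change _ ≤ (l - 1) * Nat.card I
  obtain ⟨k, rfl⟩ : ∃ k, l = k + 1 := ⟨l - 1, (Nat.sub_add_cancel hl.pos).symm⟩
  have h3 := Nat.mul_le_mul_right (Nat.card g.range) hker
  rw [Nat.add_sub_cancel]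
  nlinarith

/-- Counting vectors orthogonal to `w` and `v`, where `w i` divides `w` and `v i = 0`. -/
theorem card_dotProduct_eq_zero_mul_le {R ι : Type*} [CommRing R] [Finite R] [Fintype ι]
    (w v : ι → R) (i j : ι) (hw : ∀ k, w i ∣ w k) (hv : v i = 0) :
    Nat.card {r : ι → R // r ⬝ᵥ w = 0 ∧ r ⬝ᵥ v = 0} *
      (Nat.card (Ideal.span {w i}) * Nat.card (Ideal.span {v j})) ≤
      Nat.card R ^ Fintype.card ι := by
  classical
  let f : (ι → R) →ₗ[R] R × R :=
    { toFun := fun r => (r ⬝ᵥ w, r ⬝ᵥ v)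
      map_add' := by intro a b; simp [add_dotProduct]
      map_smul' := by intro c a; simp [smul_dotProduct] }
  have hmem1 : ∀ x ∈ Ideal.span {w i}, (x, 0) ∈ LinearMap.range f := by
    intro x hx
    obtain ⟨t, rfl⟩ := Ideal.mem_span_singleton.1 hx
    refine ⟨Pi.single i t, ?_⟩
    simp [f, hv, mul_comm]
  have hmem2 : ∀ y ∈ Ideal.span {v j}, (0, y) ∈ LinearMap.range f := by
    intro y hy
    obtain ⟨t, rfl⟩ := Ideal.mem_span_singleton.1 hy
    have h1 := hmem1 (t * w j)
      (Ideal.mul_mem_left _ _ (Ideal.mem_span_singleton.2 (hw j)))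
    have h2 : f (Pi.single j t) ∈ LinearMap.range f := ⟨_, rfl⟩
    convert Submodule.sub_mem _ h2 h1 using 1
    simp [f, mul_comm]
  have hrange : ∀ p : Ideal.span {w i} × Ideal.span {v j},
      (p.1.1, p.2.1) ∈ f.toAddMonoidHom.range := by
    rintro ⟨x, y⟩
    simpa using Submodule.add_mem _ (hmem1 x x.2) (hmem2 y y.2)
  have hle : Nat.card (Ideal.span {w i}) * Nat.card (Ideal.span {v j}) ≤
      Nat.card f.toAddMonoidHom.range := by
    rw [← Nat.card_prod]
    refine Nat.card_le_card_of_injective (fun p => (⟨_, hrange p⟩ : f.toAddMonoidHom.range))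
      fun p q h => ?_
    have h' := congrArg Subtype.val h
    exact Prod.ext (Subtype.ext (congrArg Prod.fst h')) (Subtype.ext (congrArg Prod.snd h'))
  have hker : Nat.card {r : ι → R // r ⬝ᵥ w = 0 ∧ r ⬝ᵥ v = 0} =
      Nat.card f.toAddMonoidHom.ker :=
    Nat.card_congr (Equiv.subtypeEquivRight fun r => by
      simp [AddMonoidHom.mem_ker, f])
  calc _ ≤ Nat.card f.toAddMonoidHom.ker * Nat.card f.toAddMonoidHom.range := by
        rw [hker]; exact Nat.mul_le_mul_left _ hle
    _ = Nat.card R ^ Fintype.card ι := by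
        rw [← AddSubgroup.index_ker, AddSubgroup.card_mul_index, Nat.card_fun,
          Nat.card_eq_fintype_card (α := ι)]

/-- A surjective local homomorphism `R → F` with `F` a field allows one to bound `|GL_m(R)|` from
below by the number of matrices whose reduction is invertible. -/
theorem card_matrix_mul_card_GL_le {R F : Type*} [CommRing R] [Finite R] [Field F] (f : R →+* F)
    (hf : Function.Surjective f) [IsLocalHom f] (m : ℕ) :
    Nat.card (Matrix (Fin m) (Fin m) R) * Nat.card (GL (Fin m) F) ≤
      Nat.card (Matrix (Fin m) (Fin m) F) * Nat.card (GL (Fin m) R) := by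
  let φ : Matrix (Fin m) (Fin m) R →+* Matrix (Fin m) (Fin m) F := f.mapMatrix
  have hφ : Function.Surjective φ := fun A =>
    ⟨A.map (Function.surjInv hf), by ext i j; exact Function.surjInv_eq hf _⟩
  let ψ := φ.toAddMonoidHom
  have hcard : Nat.card ψ.ker * Nat.card (Matrix (Fin m) (Fin m) F) =
      Nat.card (Matrix (Fin m) (Fin m) R) := by
    have htop : ψ.range = ⊤ := AddMonoidHom.range_eq_top.2 hφ
    rw [← AddSubgroup.card_mul_index ψ.ker, AddSubgroup.index_ker, htop, AddSubgroup.card_top]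
  have hred : ∀ p : GL (Fin m) F × ψ.ker,
      φ (Function.surjInv hφ p.1.val + p.2.1) = p.1.val := fun p => by
    rw [map_add, Function.surjInv_eq hφ, show φ p.2.1 = 0 from p.2.2, add_zero]
  have hunit : ∀ p : GL (Fin m) F × ψ.ker, IsUnit (Function.surjInv hφ p.1.val + p.2.1) := by
    intro p
    rw [Matrix.isUnit_iff_isUnit_det]
    refine IsUnit.of_map f _ ?_
    rw [RingHom.map_det, ← Matrix.isUnit_iff_isUnit_det]
    exact (hred p).symm ▸ p.1.isUnit
  have hinj : Function.Injective fun p : GL (Fin m) F × ψ.ker => (hunit p).unit := by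
    intro p q h
    have h' : Function.surjInv hφ p.1.val + p.2.1 = Function.surjInv hφ q.1.val + q.2.1 :=
      congrArg Units.val h
    have h1 : p.1 = q.1 := Units.ext (by rw [← hred p, ← hred q, h'])
    rw [h1] at h'
    exact Prod.ext h1 (Subtype.ext (add_left_cancel h'))
  have hle := Nat.card_le_card_of_injective _ hinj
  rw [Nat.card_prod] at hle
  rw [← hcard]
  calc _ = Nat.card (Matrix (Fin m) (Fin m) F) *
        (Nat.card (GL (Fin m) F) * Nat.card ψ.ker) := by ring
    _ ≤ _ := Nat.mul_le_mul_left _ hle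

theorem card_GL_field_eq_mul_prod {F : Type*} [Field F] [Fintype F] (m : ℕ) :
    (Nat.card (GL (Fin m) F) : ℝ) = (Fintype.card F : ℝ) ^ (m * m) *
      ∏ k ∈ Finset.Icc 1 m, (1 - ((Fintype.card F : ℝ) ^ k)⁻¹) := by
  have hq : (Fintype.card F : ℝ) ≠ 0 := by exact_mod_cast Fintype.card_ne_zero
  have hq1 : 1 ≤ Fintype.card F := Fintype.card_pos
  rw [Matrix.card_GL_field, Nat.cast_prod]
  have hterm : ∀ i : Fin m, ((Fintype.card F ^ m - Fintype.card F ^ (i : ℕ) : ℕ) : ℝ) =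
      (Fintype.card F : ℝ) ^ m * (1 - ((Fintype.card F : ℝ) ^ (m - (i : ℕ)))⁻¹) := by
    intro i
    rw [Nat.cast_sub (Nat.pow_le_pow_right hq1 i.2.le), Nat.cast_pow, Nat.cast_pow, mul_sub,
      mul_one, pow_sub₀ _ hq i.2.le]
    field_simp
  rw [Finset.prod_congr rfl fun i _ => hterm i, Finset.prod_mul_distrib, Finset.prod_const,
    Finset.card_univ, Fintype.card_fin, pow_mul,
    ← Finset.prod_range fun i => (1 - ((Fintype.card F : ℝ) ^ (m - i))⁻¹),
    ← Nat.Ico_zero_eq_range,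
    Finset.prod_Ico_reflect (fun k => 1 - ((Fintype.card F : ℝ) ^ k)⁻¹) 0 m.le_succ,
    Nat.add_sub_cancel_left, Nat.sub_zero]
  rfl

theorem ZMod.pow_mul_prod_le_card_GL {l : ℕ} (hl : l.Prime) {e : ℕ} (he : 1 ≤ e) (m : ℕ) :
    ((l ^ e : ℕ) : ℝ) ^ (m * m) * ∏ k ∈ Finset.Icc 1 m, (1 - ((l : ℝ) ^ k)⁻¹) ≤
      Nat.card (GL (Fin m) (ZMod (l ^ e))) := by
  have : Fact l.Prime := ⟨hl⟩
  have : NeZero (l ^ e) := ⟨pow_ne_zero _ hl.ne_zero⟩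
  have hdvd : l ∣ l ^ e := dvd_pow_self l (Nat.one_le_iff_ne_zero.1 he)
  let f : ZMod (l ^ e) →+* ZMod l := ZMod.castHom hdvd (ZMod l)
  have hloc : IsLocalHom f := by
    refine ⟨fun x hx => ?_⟩
    rw [← ZMod.natCast_zmod_val x] at hx ⊢
    rw [map_natCast, ZMod.isUnit_iff_coprime] at hx
    exact (ZMod.isUnit_iff_coprime _ _).2 (hx.pow_right e)
  have h := card_matrix_mul_card_GL_le f (ZMod.castHom_surjective hdvd) m
  have hM : ∀ (n : ℕ), Nat.card (Matrix (Fin m) (Fin m) (ZMod n)) = n ^ (m * m) := by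
    intro n
    simp [Matrix, Nat.card_fun, pow_mul]
  rw [hM, hM] at h
  have h' : (((l ^ e) ^ (m * m) * Nat.card (GL (Fin m) (ZMod l)) : ℕ) : ℝ) ≤
    ((l ^ (m * m) * Nat.card (GL (Fin m) (ZMod (l ^ e))) : ℕ) : ℝ) := by exact_mod_cast h
  rw [Nat.cast_mul, Nat.cast_mul, card_GL_field_eq_mul_prod, ZMod.card] at h'
  have hpos : (0 : ℝ) < (l : ℝ) ^ (m * m) := by
    have := hl.pos
    positivity
  refine le_of_mul_le_mul_left ?_ hpos
  push_cast at h' ⊢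
  linarith

/-- A group `Γ` of invertible matrices acting abelianly on an invariant submodule `W` is small.
Here `w i` is a coordinate of an element of `W` that divides all coordinates of elements of `W`. -/
theorem card_mul_pow_le_of_abelian_action {R : Type*} [CommRing R] [Finite R]
    (htot : ∀ x y : R, x ∣ y ∨ y ∣ x) {m : ℕ} (Γ : Subgroup (GL (Fin m) R))
    (W : Submodule R (Fin m → R))
    (hinv : ∀ g ∈ Γ, ∀ w ∈ W, (g : GL (Fin m) R).val.mulVec w ∈ W)
    (habel : ∀ A ∈ Γ, ∀ B ∈ Γ, ∀ w ∈ W,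
      ((A * B : GL (Fin m) R).val).mulVec w = ((B * A : GL (Fin m) R).val).mulVec w)
    {w : Fin m → R} (hw : w ∈ W) (i : Fin m) (hdvd : ∀ v ∈ W, ∀ k, w i ∣ v k)
    {l : ℕ} (hl : 2 ≤ l)
    (hgen : {y | w i ∣ y ∧ y ∣ w i}.ncard * l ≤ (l - 1) * Nat.card (Ideal.span {w i})) :
    Nat.card Γ * Nat.card (Ideal.span {w i}) ^ m * l ≤
      (l - 1) * Nat.card (Ideal.span {w i}) * Nat.card R ^ (m * m) := by
  classical
  have hc : ∀ x : R, ∃ c, w i ∣ x → x = c * w i := fun x => by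
    by_cases h : w i ∣ x
    · obtain ⟨c, hc⟩ := h
      exact ⟨c, fun _ => by rw [hc, mul_comm]⟩
    · exact ⟨0, fun h' => absurd h' h⟩
  choose c hc using hc
  -- `δ v` is the part of `v` transverse to `w`
  let δ : (Fin m → R) → Fin m → R := fun v => v - c (v i) • w
  have hδ : ∀ v, v = δ v + c (v i) • w := fun v => (sub_add_cancel v _).symm
  have hδi : ∀ v ∈ W, δ v i = 0 := fun v hv => by
    simp only [δ, Pi.sub_apply, Pi.smul_apply, smul_eq_mul]
    rw [← hc (v i) (hdvd v hv i), sub_self]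
  let π : Γ → Fin m → R := fun g => g.1.val *ᵥ w
  let S : Set (Fin m → R) := Set.range π
  have hSW : ∀ v ∈ S, v ∈ W := by
    rintro _ ⟨g, rfl⟩
    exact hinv g.1 g.2 w hw
  obtain ⟨x, ⟨v, hvS, j, rfl⟩, hmin⟩ := exists_mem_forall_dvd_of_dvd_total htot
    {x | ∃ v ∈ S, ∃ k, δ v k = x} ⟨_, π 1, ⟨1, rfl⟩, i, rfl⟩
  have hmin' : ∀ u ∈ S, ∀ k, δ v j ∣ δ u k := fun u hu k => hmin _ ⟨u, hu, k, rfl⟩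
  set α := Nat.card (Ideal.span {w i}) with hα
  set β := Nat.card (Ideal.span {δ v j}) with hβ
  have hβpos : 0 < β := Nat.card_pos
  have hαpos : 0 < α := Nat.card_pos
  have horbit : Nat.card S ≤ α * β ^ (m - 1) := by
    have hcard : Nat.card (Ideal.span {w i} × ({k : Fin m // k ≠ i} → Ideal.span {δ v j})) =
        α * β ^ (m - 1) := by
      rw [Nat.card_prod, Nat.card_fun, Nat.card_eq_fintype_card (α := {k : Fin m // k ≠ i})]
      simp [Fintype.card_subtype_compl, hα, hβ]
    rw [← hcard]
    refine Nat.card_le_card_of_injective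
      (fun u : S => (⟨⟨u.1 i, Ideal.mem_span_singleton.2 (hdvd _ (hSW _ u.2) i)⟩,
        fun k => ⟨δ u.1 k, Ideal.mem_span_singleton.2 (hmin' _ u.2 k)⟩⟩ :
        Ideal.span {w i} × ({k : Fin m // k ≠ i} → Ideal.span {δ v j}))) fun a b h => ?_
    have h1 : a.1 i = b.1 i := congrArg (fun p => p.1.1) h
    have h2 : δ a.1 = δ b.1 := by
      funext k
      by_cases hk : k = i
      · rw [hk, hδi _ (hSW _ a.2), hδi _ (hSW _ b.2)]
      · exact congrArg (fun p => (p.2 ⟨k, hk⟩).1) h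
    exact Subtype.ext (by rw [hδ a.1, hδ b.1, h1, h2])
  have horbit' : Nat.card S * l ≤ (l - 1) * α * β ^ m := by
    have hm : m = m - 1 + 1 := (Nat.sub_add_cancel (i.pos)).symm
    by_cases hβ1 : β = 1
    · have hzero : ∀ u ∈ S, δ u = 0 := by
        have hv0 : δ v j = 0 := by
          have : Subsingleton (Ideal.span {δ v j}) := (Nat.card_eq_one_iff_unique.1 hβ1).1
          exact congrArg Subtype.val (Subsingleton.elim
            (⟨δ v j, Ideal.mem_span_singleton_self _⟩ : Ideal.span {δ v j}) 0)
        exact fun u hu => funext fun k => zero_dvd_iff.1 (hv0 ▸ hmin' u hu k)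
      have hle : Nat.card S ≤ {y | w i ∣ y ∧ y ∣ w i}.ncard := by
        refine Set.ncard_le_ncard_of_injOn (fun u => u i) ?_ ?_ (Set.toFinite _)
        · rintro _ ⟨g, rfl⟩
          refine ⟨hdvd _ (hSW _ ⟨g, rfl⟩) i, ?_⟩
          have h1 : π g = c (π g i) • w := by
            conv_lhs => rw [hδ (π g), hzero _ ⟨g, rfl⟩, zero_add]
          have h2 : w = c (π g i) • ((g⁻¹ : Γ).1.val *ᵥ w) := by
            rw [← mulVec_smul, ← h1]
            simp [π, mulVec_mulVec]
          obtain ⟨d, hd⟩ := hdvd _ (hinv _ (g⁻¹).2 w hw) i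
          refine ⟨d, ?_⟩
          have h3 := congrFun h2 i
          have h4 := congrFun h1 i
          simp only [Pi.smul_apply, smul_eq_mul] at h3 h4
          change w i = π g i * d
          rw [h4]
          rw [hd] at h3
          linear_combination h3
        · intro a ha b hb hab
          change a i = b i at hab
          rw [hδ a, hδ b, hzero a ha, hzero b hb, hab]
      rw [hβ1, one_pow, mul_one]
      exact (Nat.mul_le_mul_right l hle).trans hgen
    · have hβ2 : 2 ≤ β := by omega
      have hlβ : l ≤ (l - 1) * β := by
        calc l ≤ (l - 1) * 2 := by omega
          _ ≤ _ := Nat.mul_le_mul_left _ hβ2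
      calc Nat.card S * l ≤ (α * β ^ (m - 1)) * ((l - 1) * β) := Nat.mul_le_mul horbit hlβ
        _ = (l - 1) * α * β ^ (m - 1 + 1) := by ring
        _ = _ := by rw [← hm]
  let K := {r : Fin m → R // r ⬝ᵥ w = 0 ∧ r ⬝ᵥ δ v = 0}
  have hK : Nat.card K * (α * β) ≤ Nat.card R ^ m := by
    simpa using card_dotProduct_eq_zero_mul_le w (δ v) i j (hdvd w hw) (hδi v (hSW v hvS))
  have hfib : ∀ g h : Γ, π g = π h → ∀ k,
      (g.1.val - h.1.val) k ⬝ᵥ w = 0 ∧ (g.1.val - h.1.val) k ⬝ᵥ δ v = 0 := by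
    intro g h hgh k
    have h1 : (g.1.val - h.1.val) *ᵥ w = 0 := by
      rw [sub_mulVec]; exact sub_eq_zero.2 hgh
    have h2 : (g.1.val - h.1.val) *ᵥ v = 0 := by
      obtain ⟨t, rfl⟩ := hvS
      have hcomm : ∀ s : Γ, s.1.val *ᵥ π t = t.1.val *ᵥ π s := fun s => by
        simpa [π, mulVec_mulVec] using habel s.1 s.2 t.1 t.2 w hw
      rw [sub_mulVec, hcomm g, hcomm h, hgh, sub_self]
    have h3 : (g.1.val - h.1.val) *ᵥ δ v = 0 := by
      simp only [δ, mulVec_sub, mulVec_smul, h1, h2, smul_zero, sub_zero]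
    exact ⟨congrFun h1 k, congrFun h3 k⟩
  have hΓ : Nat.card Γ ≤ Nat.card S * Nat.card K ^ m := by
    let s : S → Γ := fun u => u.2.choose
    have hs : ∀ u : S, π (s u) = u := fun u => u.2.choose_spec
    have hcard : Nat.card (S × (Fin m → K)) = Nat.card S * Nat.card K ^ m := by
      simp [Nat.card_prod, Nat.card_fun]
    rw [← hcard]
    refine Nat.card_le_card_of_injective (fun g : Γ => ((⟨π g, g, rfl⟩ : S),
      fun k => (⟨_, hfib g (s ⟨π g, g, rfl⟩) (hs ⟨π g, g, rfl⟩).symm k⟩ : K))) fun a b h => ?_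
    have h1 : (⟨π a, a, rfl⟩ : S) = ⟨π b, b, rfl⟩ := congrArg Prod.fst h
    have h2 : ∀ k, (a.1.val - (s ⟨π a, a, rfl⟩).1.val) k =
        (b.1.val - (s ⟨π b, b, rfl⟩).1.val) k := fun k => congrArg (fun p => (p.2 k).1) h
    rw [h1] at h2
    exact Subtype.ext (Units.ext (sub_left_injective (funext h2)))
  refine Nat.le_of_mul_le_mul_right ?_ (pow_pos hβpos m)
  calc Nat.card Γ * α ^ m * l * β ^ m
      ≤ (Nat.card S * Nat.card K ^ m) * α ^ m * l * β ^ m := by gcongr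
    _ = (Nat.card S * l) * (Nat.card K * (α * β)) ^ m := by ring
    _ ≤ ((l - 1) * α * β ^ m) * (Nat.card R ^ m) ^ m := by gcongr
    _ = (l - 1) * α * Nat.card R ^ (m * m) * β ^ m := by ring

/-- If `α` is the size of the largest principal ideal generated by a coordinate of an element of
`W`, then the index of `Γ` is at least `α ^ (m - 1) * ∏_{k=2}^m (1 - l^{-k})`. -/
theorem prod_mul_pow_le_index_of_abelian_action {l : ℕ} (hl : l.Prime) {e : ℕ} (he : 1 ≤ e) {m : ℕ}
    (Γ : Subgroup (GL (Fin m) (ZMod (l ^ e))))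
    (W : Submodule (ZMod (l ^ e)) (Fin m → ZMod (l ^ e)))
    (hinv : ∀ g ∈ Γ, ∀ w ∈ W, (g : GL (Fin m) (ZMod (l ^ e))).val.mulVec w ∈ W)
    (habel : ∀ A ∈ Γ, ∀ B ∈ Γ, ∀ w ∈ W,
      ((A * B : GL (Fin m) (ZMod (l ^ e))).val).mulVec w =
      ((B * A : GL (Fin m) (ZMod (l ^ e))).val).mulVec w)
    {w : Fin m → ZMod (l ^ e)} (hw : w ∈ W) (i : Fin m) (hdvd : ∀ v ∈ W, ∀ k, w i ∣ v k) :
    (∏ k ∈ Finset.Icc 2 m, (1 - ((l : ℝ) ^ k)⁻¹)) *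
      (Nat.card (Ideal.span {w i}) : ℝ) ^ (m - 1) ≤ Γ.index := by
  have : NeZero (l ^ e) := ⟨pow_ne_zero _ hl.ne_zero⟩
  have hl1 : (1 : ℝ) < l := by exact_mod_cast hl.one_lt
  by_cases hx : w i = 0
  · have hI : (1 : ℝ) ≤ Γ.index := by
      exact_mod_cast Nat.one_le_iff_ne_zero.2 Γ.index_ne_zero_of_finite
    refine le_trans ?_ hI
    rw [hx, Ideal.span_singleton_zero,
      (Nat.card_unique : Nat.card (⊥ : Ideal (ZMod (l ^ e))) = 1), Nat.cast_one, one_pow, mul_one]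
    refine Finset.prod_le_one (fun k _ => ?_) fun k _ => ?_
    · exact sub_nonneg.2 (inv_le_one_of_one_le₀ (one_le_pow₀ hl1.le))
    · exact sub_le_self _ (by positivity)
  have h1 := card_mul_pow_le_of_abelian_action (ZMod.dvd_total_of_prime_pow hl e) Γ W hinv habel hw
    i hdvd hl.two_le (ZMod.ncard_generators_mul_le hl e hx)
  have h2 := ZMod.pow_mul_prod_le_card_GL hl he m
  rw [Nat.card_zmod] at h1
  rw [← Γ.card_mul_index, ← Finset.mul_prod_Ioc_eq_prod_Icc i.pos, pow_one] at h2
  change _ * (_ * ∏ k ∈ Finset.Icc 2 m, _) ≤ _ at h2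
  have hα : 0 < Nat.card (Ideal.span {w i}) := Nat.card_pos
  have hN : 0 < (l ^ e) ^ (m * m) := pow_pos (pow_pos hl.pos e) _
  have hm : m = m - 1 + 1 := (Nat.sub_add_cancel i.pos).symm
  have h1' : ((Nat.card Γ * Nat.card (Ideal.span {w i}) ^ m * l : ℕ) : ℝ) ≤
    (((l - 1) * Nat.card (Ideal.span {w i}) * (l ^ e) ^ (m * m) : ℕ) : ℝ) := by exact_mod_cast h1
  rw [Nat.cast_mul _ l, Nat.cast_mul, Nat.cast_mul, Nat.cast_mul, Nat.cast_sub hl.pos,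
    Nat.cast_pow, Nat.cast_pow _ (m * m), Nat.cast_one] at h1'
  generalize ∏ k ∈ Finset.Icc 2 m, (1 - ((l : ℝ) ^ k)⁻¹) = P at h2 ⊢
  have hα' : (0 : ℝ) < Nat.card (Ideal.span {w i}) := by exact_mod_cast hα
  have hN' : (0 : ℝ) < ((l ^ e : ℕ) : ℝ) ^ (m * m) := by exact_mod_cast hN
  generalize (Nat.card (Ideal.span {w i}) : ℝ) = α at h1' hα' ⊢
  generalize ((l ^ e : ℕ) : ℝ) ^ (m * m) = N at h1' h2 hN'
  rw [Nat.cast_mul] at h2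
  have hpos : 0 < ((l : ℝ) - 1) * α * N := mul_pos (mul_pos (sub_pos.2 hl1) hα') hN'
  refine le_of_mul_le_mul_left ?_ hpos
  calc (l - 1) * α * N * (P * α ^ (m - 1))
      = N * ((1 - (l : ℝ)⁻¹) * P) * (α ^ (m - 1 + 1) * l) := by field_simp; ring
    _ ≤ (Nat.card Γ * Γ.index) * (α ^ (m - 1 + 1) * l) := by gcongr
    _ = Γ.index * (Nat.card Γ * α ^ m * l) := by rw [← hm]; ring
    _ ≤ Γ.index * ((l - 1) * α * N) := by gcongr
    _ = (l - 1) * α * N * Γ.index := mul_comm _ _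

/-- **Prime-power case of the general linear estimate.** For `n = l^e` a prime power,
if `Γ ≤ GL_m(ℤ/nℤ)` acts abelianly on a `Γ`-invariant submodule `W` of `(ℤ/nℤ)^m`, then
`I(Γ)^(1 + m/2) ≥ |W| · (∏_{k=2}^m (1 - l^{-k}))^(1 + m/2)`. -/
theorem index_rpow_ge_card_mul_of_abelian_action_GL_primePow
    (l : ℕ) (hl : l.Prime) (e m : ℕ) (he : 1 ≤ e) (hm : 2 ≤ m)
    (Γ : Subgroup (GL (Fin m) (ZMod (l ^ e))))
    (W : Submodule (ZMod (l ^ e)) (Fin m → ZMod (l ^ e)))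
    (hinv : ∀ g ∈ Γ, ∀ w ∈ W, (g : GL (Fin m) (ZMod (l ^ e))).val.mulVec w ∈ W)
    (habel : ∀ A ∈ Γ, ∀ B ∈ Γ, ∀ w ∈ W,
      ((A * B : GL (Fin m) (ZMod (l ^ e))).val).mulVec w =
      ((B * A : GL (Fin m) (ZMod (l ^ e))).val).mulVec w) :
    (Γ.index : ℝ) ^ ((1 : ℝ) + (m : ℝ) / 2) ≥
      (Nat.card W : ℝ) *
        (∏ k ∈ Finset.Icc 2 m, (1 - ((l : ℝ) ^ k)⁻¹)) ^ ((1 : ℝ) + (m : ℝ) / 2) := by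
  have : NeZero (l ^ e) := ⟨pow_ne_zero _ hl.ne_zero⟩
  have hl1 : (1 : ℝ) < l := by exact_mod_cast hl.one_lt
  obtain ⟨_, ⟨w, hw, i, rfl⟩, hmin⟩ :=
    exists_mem_forall_dvd_of_dvd_total (ZMod.dvd_total_of_prime_pow hl e)
      {x | ∃ w ∈ W, ∃ k, w k = x} ⟨_, 0, W.zero_mem, ⟨0, by omega⟩, rfl⟩
  have hdvd : ∀ v ∈ W, ∀ k, w i ∣ v k := fun v hv k => hmin _ ⟨v, hv, k, rfl⟩
  have hindex := prod_mul_pow_le_index_of_abelian_action hl he Γ W hinv habel hw i hdvd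
  have hW : Nat.card W ≤ Nat.card (Ideal.span {w i}) ^ m := by
    have hcard : Nat.card (Fin m → Ideal.span {w i}) = Nat.card (Ideal.span {w i}) ^ m := by
      simp [Nat.card_fun]
    rw [← hcard]
    refine Nat.card_le_card_of_injective
      (fun v : W => fun k => (⟨v.1 k, Ideal.mem_span_singleton.2 (hdvd _ v.2 k)⟩ :
        Ideal.span {w i})) fun a b h => ?_
    exact Subtype.ext (funext fun k => congrArg (fun p => (p k).1) h)
  have hα : (1 : ℝ) ≤ Nat.card (Ideal.span {w i}) := by
    exact_mod_cast (Nat.card_pos : 0 < Nat.card (Ideal.span {w i}))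
  have hW' : (Nat.card W : ℝ) ≤ (Nat.card (Ideal.span {w i}) : ℝ) ^ m := by exact_mod_cast hW
  have hP : 0 ≤ ∏ k ∈ Finset.Icc 2 m, (1 - ((l : ℝ) ^ k)⁻¹) := Finset.prod_nonneg fun k _ =>
    sub_nonneg.2 (inv_le_one_of_one_le₀ (one_le_pow₀ hl1.le))
  generalize ∏ k ∈ Finset.Icc 2 m, (1 - ((l : ℝ) ^ k)⁻¹) = P at hindex hP ⊢
  generalize (Nat.card (Ideal.span {w i}) : ℝ) = α at hindex hα hW'
  have hm' : (2 : ℝ) ≤ m := by exact_mod_cast hm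
  have hexp : α ^ m ≤ (α ^ (m - 1)) ^ ((1 : ℝ) + (m : ℝ) / 2) := by
    rw [← Real.rpow_natCast, ← Real.rpow_natCast, ← Real.rpow_mul (by linarith),
      Nat.cast_sub (by omega), Nat.cast_one]
    exact Real.rpow_le_rpow_of_exponent_le hα (by nlinarith)
  calc (Nat.card W : ℝ) * P ^ ((1 : ℝ) + (m : ℝ) / 2)
      ≤ (α ^ (m - 1)) ^ ((1 : ℝ) + (m : ℝ) / 2) * P ^ ((1 : ℝ) + (m : ℝ) / 2) := by
        gcongr
        exact hW'.trans hexp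
    _ = (P * α ^ (m - 1)) ^ ((1 : ℝ) + (m : ℝ) / 2) := by
        rw [Real.mul_rpow hP (by positivity), mul_comm]
    _ ≤ (Γ.index : ℝ) ^ ((1 : ℝ) + (m : ℝ) / 2) := by gcongr
end

section
/- Let l be a prime, e ≥ 1 and m ≥ 1 integers, and set n = l^e. Let Γ be a subgroup of the symplectic group Sp(2m, ZMod n), and let W be a Γ-invariant ZMod n-submodule of (ZMod n)^(2m) on which Γ acts abelianly. Let I(Γ) be the index of Γ in Sp(2m, ZMod n). Then I(Γ)^(2 + 2m) ≥ |W| · (∏_{i=1}^{m} (1 - l^{-2i}))^(2 + 2m). -/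
open Matrix

/-- If `A` and `B` generate a Heisenberg-type group with commutator `C`, then some power `C ^ N`
with `N` at most the index of `Γ` is a commutator of two elements of `Γ`. -/
theorem Subgroup.exists_mul_eq_pow_mul_of_heisenberg {G : Type*} [Group G] (Γ : Subgroup G)
    (hΓ : Γ.index ≠ 0) {A B C : G} (hAB : A * B = C * (B * A)) (hCA : Commute C A)
    (hCB : Commute C B) :
    ∃ N, 0 < N ∧ N ≤ Γ.index ∧ ∃ g ∈ Γ, ∃ h ∈ Γ, g * h = C ^ N * (h * g) := by
  classical
  have comm : ∀ a b : ℕ, A ^ a * B ^ b = C ^ (a * b) * (B ^ b * A ^ a) := by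
    have h1 : ∀ b : ℕ, A * B ^ b = C ^ b * (B ^ b * A) := by
      intro b
      induction b with
      | zero => simp
      | succ b ih =>
        rw [pow_succ, ← mul_assoc, ih, mul_assoc, mul_assoc, hAB, ← mul_assoc (B ^ b),
          ← (hCB.pow_right b).eq, pow_succ]
        simp only [mul_assoc]
    intro a b
    induction a with
    | zero => simp
    | succ a ih =>
      rw [pow_succ', mul_assoc, ih, ← mul_assoc, ← (hCA.pow_left (a * b)).eq, mul_assoc,
        ← mul_assoc A, h1, add_mul, one_mul, pow_add]
      simp only [mul_assoc]
  have hA : ∃ a, 0 < a ∧ A ^ a ∈ Γ := by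
    obtain ⟨a, h0, -, h⟩ := Γ.exists_pow_mem_of_index_ne_zero hΓ A
    exact ⟨a, h0, h⟩
  have hB : ∃ b, 0 < b ∧ ∃ y, Commute A y ∧ B ^ b * y ∈ Γ := by
    obtain ⟨b, h0, -, h⟩ := Γ.exists_pow_mem_of_index_ne_zero hΓ B
    exact ⟨b, h0, 1, Commute.one_right A, by simpa using h⟩
  obtain ⟨ha0, haΓ⟩ := Nat.find_spec hA
  obtain ⟨hb0, y, hy, hbΓ⟩ := Nat.find_spec hB
  set a := Nat.find hA with ha
  set b := Nat.find hB with hb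
  have hfin : Finite (G ⧸ Γ) := @Subgroup.finite_quotient_of_finiteIndex _ _ Γ ⟨hΓ⟩
  have key_t : ∀ s t s' t' : ℕ, t' < b → t < t' →
      ((B ^ t * A ^ s : G) : G ⧸ Γ) ≠ ((B ^ t' * A ^ s' : G) : G ⧸ Γ) := by
    intro s t s' t' ht' htt h
    rw [QuotientGroup.eq] at h
    obtain ⟨δ, rfl⟩ := Nat.exists_eq_add_of_lt htt
    refine Nat.find_min hB (m := δ + 1) (by omega)
      ⟨by omega, (B ^ (δ + 1))⁻¹ * (A ^ s)⁻¹ * B ^ (δ + 1) * A ^ s', ?_, ?_⟩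
    · have h2 : (B ^ (δ + 1))⁻¹ * (A ^ s)⁻¹ * B ^ (δ + 1) = (C ^ (s * (δ + 1)) * A ^ s)⁻¹ := by
        have h3 := comm s (δ + 1)
        rw [← mul_assoc, ((hCB.pow_left (s * (δ + 1))).pow_right (δ + 1)).eq, mul_assoc] at h3
        rw [mul_assoc, inv_mul_eq_iff_eq_mul, inv_mul_eq_iff_eq_mul, ← mul_assoc, h3]
        group
      rw [h2]
      exact ((hCA.symm.pow_right _).mul_right (Commute.self_pow A s)).inv_right.mul_right
        (Commute.self_pow A s')
    · convert h using 1
      rw [show t + δ + 1 = t + (δ + 1) by ring, pow_add B t]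
      group
  have key_s : ∀ s s' t : ℕ, s' < a → s < s' →
      ((B ^ t * A ^ s : G) : G ⧸ Γ) ≠ ((B ^ t * A ^ s' : G) : G ⧸ Γ) := by
    intro s s' t hs' hss h
    rw [QuotientGroup.eq] at h
    obtain ⟨δ, rfl⟩ := Nat.exists_eq_add_of_lt hss
    refine Nat.find_min hA (m := δ + 1) (by omega) ⟨by omega, ?_⟩
    convert h using 1
    rw [show s + δ + 1 = s + (δ + 1) by ring, pow_add A s]
    group
  refine ⟨a * b, Nat.mul_pos ha0 hb0, ?_, A ^ a, haΓ, B ^ b * y, hbΓ, ?_⟩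
  · let f : Fin a × Fin b → G ⧸ Γ := fun x => ((B ^ (x.2 : ℕ) * A ^ (x.1 : ℕ) : G) : G ⧸ Γ)
    have hf : Function.Injective f := by
      rintro ⟨s, t⟩ ⟨s', t'⟩ h
      have ht : t = t' := by
        rcases lt_trichotomy t t' with h1 | h1 | h1
        · exact absurd h (key_t _ _ _ _ t'.2 h1)
        · exact h1
        · exact absurd h.symm (key_t _ _ _ _ t.2 h1)
      subst ht
      have hs : s = s' := by
        rcases lt_trichotomy s s' with h1 | h1 | h1
        · exact absurd h (key_s _ _ _ s'.2 h1)
        · exact h1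
        · exact absurd h.symm (key_s _ _ _ s.2 h1)
      rw [hs]
    simpa [Subgroup.index] using Nat.card_le_card_of_injective f hf
  · rw [← mul_assoc, comm, mul_assoc, mul_assoc, (hy.pow_left a).eq]
    simp only [mul_assoc]

/-- The matrix `1 + S * Ω`, for `S` symmetric with `S * Ω * S = 0`, as a symplectic matrix. -/
def Sp.ofSymm {m : ℕ} {R : Type*} [CommRing R] (S : Matrix (Fin m ⊕ Fin m) (Fin m ⊕ Fin m) R)
    (hS : Sᵀ = S) (hS2 : S * Omega m R * S = 0) : Sp m R :=
  ⟨⟨1 + S * Omega m R, 1 - S * Omega m R, by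
      have : S * Omega m R * (S * Omega m R) = 0 := by rw [← mul_assoc, hS2, zero_mul]
      rw [add_mul, mul_sub, mul_sub, this]; simp, by
      have : S * Omega m R * (S * Omega m R) = 0 := by rw [← mul_assoc, hS2, zero_mul]
      rw [sub_mul, mul_add, mul_add, this]; simp⟩, by
    have hΩ : (Omega m R)ᵀ = -Omega m R := by
      simp [Omega, Matrix.fromBlocks_transpose, Matrix.fromBlocks_neg]
    change (1 + S * Omega m R)ᵀ * Omega m R * (1 + S * Omega m R) = Omega m R
    rw [transpose_add, transpose_mul, hS, hΩ, transpose_one]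
    have : Omega m R * S * Omega m R * (S * Omega m R) = 0 := by
      rw [show Omega m R * S * Omega m R * (S * Omega m R) =
        Omega m R * (S * Omega m R * S) * Omega m R by simp only [mul_assoc], hS2]
      simp
    simp only [add_mul, mul_add, neg_mul, this]
    simp [mul_assoc]⟩

theorem Sp.coe_ofSymm_pow {m : ℕ} {R : Type*} [CommRing R]
    (S : Matrix (Fin m ⊕ Fin m) (Fin m ⊕ Fin m) R)
    (hS : Sᵀ = S) (hS2 : S * Omega m R * S = 0) (N : ℕ) :
    ((Sp.ofSymm S hS hS2 ^ N : Sp m R) : GL (Fin m ⊕ Fin m) R).val =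
      1 + N • (S * Omega m R) := by
  have h0 : S * Omega m R * (S * Omega m R) = 0 := by rw [← mul_assoc, hS2, zero_mul]
  induction N with
  | zero => simp
  | succ N ih =>
    rw [pow_succ]
    change ((Sp.ofSymm S hS hS2 ^ N : Sp m R) : GL (Fin m ⊕ Fin m) R).val *
      (1 + S * Omega m R) = _
    rw [ih, add_mul, mul_add, mul_add, smul_mul_assoc N _ (S * Omega m R), h0, add_smul]
    simp only [one_mul, mul_one, smul_zero, add_zero, one_smul]
    abel

theorem Omega_self {m : ℕ} {R : Type*} [CommRing R] (p : Fin m ⊕ Fin m) :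
    Omega m R p p = 0 := by
  rcases p with p | p <;> simp [Omega]

theorem Omega_swap {m : ℕ} {R : Type*} [CommRing R] (p q : Fin m ⊕ Fin m) :
    Omega m R p q = -Omega m R q p := by
  rcases p with p | p <;> rcases q with q | q <;> simp [Omega, Matrix.one_apply, eq_comm]

theorem Omega_mulVec_swap {m : ℕ} {R : Type*} [CommRing R] (p : Fin m ⊕ Fin m)
    (w : Fin m ⊕ Fin m → R) :
    (Omega m R *ᵥ w) p.swap = w p ∨ (Omega m R *ᵥ w) p.swap = -w p := by
  rcases p with p | p <;>
    simp [Omega, Matrix.fromBlocks_mulVec, Matrix.neg_mulVec]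

/-- The symmetric matrix of the quadratic form `2 * x p * x q`. -/
def symmSingle {m : ℕ} (R : Type*) [CommRing R] (p q : Fin m ⊕ Fin m) :
    Matrix (Fin m ⊕ Fin m) (Fin m ⊕ Fin m) R :=
  Matrix.single p q 1 + Matrix.single q p 1

theorem symmSingle_transpose {m : ℕ} {R : Type*} [CommRing R] (p q : Fin m ⊕ Fin m) :
    (symmSingle R p q)ᵀ = symmSingle R p q := by
  simp [symmSingle, add_comm]

theorem symmSingle_mul_Omega_mul_symmSingle {m : ℕ} {R : Type*} [CommRing R]
    (p q r s : Fin m ⊕ Fin m) :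
    symmSingle R p q * Omega m R * symmSingle R r s =
      Matrix.single p s (Omega m R q r) + Matrix.single p r (Omega m R q s) +
      Matrix.single q s (Omega m R p r) + Matrix.single q r (Omega m R p s) := by
  simp only [symmSingle, add_mul, mul_add, Matrix.single_mul_mul_single, one_mul, mul_one]
  abel

theorem symmSingle_isotropic {m : ℕ} {R : Type*} [CommRing R]
    {p q : Fin m ⊕ Fin m} (h : Omega m R p q = 0) :
    symmSingle R p q * Omega m R * symmSingle R p q = 0 := by
  simp [symmSingle_mul_Omega_mul_symmSingle, Omega_self, Omega_swap q p, h]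

/-- Some multiple `N ≤ Γ.index` of the infinitesimal generator of a long or short root subgroup
kills `W`, since the root element is a commutator of two root elements. -/
theorem exists_le_index_smul_symmSingle_mulVec_eq_zero {m : ℕ} {R : Type*} [CommRing R]
    (Γ : Subgroup (Sp m R)) (hΓ : Γ.index ≠ 0) (W : Submodule R (Fin m ⊕ Fin m → R))
    (hinv : ∀ g ∈ Γ, ∀ w ∈ W, (g : Sp m R).val.val.mulVec w ∈ W)
    (habel : ∀ A ∈ Γ, ∀ B ∈ Γ, ∀ w ∈ W,
      ((A * B : Sp m R) : GL (Fin m ⊕ Fin m) R).val.mulVec w =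
      ((B * A : Sp m R) : GL (Fin m ⊕ Fin m) R).val.mulVec w)
    {p q r s : Fin m ⊕ Fin m} (hqr : Omega m R q r = 1) (hps : Omega m R p s = 0)
    (hpq : Omega m R p q = 0) (hpr : Omega m R p r = 0) (hsq : Omega m R s q = 0)
    (hsr : Omega m R s r = 0) :
    ∃ N, 0 < N ∧ N ≤ Γ.index ∧
      ∀ w ∈ W, N • ((symmSingle R p s * Omega m R) *ᵥ w) = 0 := by
  have hrs : Omega m R r s = 0 := by rw [Omega_swap, hsr, neg_zero]
  let A := Sp.ofSymm _ (symmSingle_transpose p q) (symmSingle_isotropic hpq)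
  let B := Sp.ofSymm _ (symmSingle_transpose r s) (symmSingle_isotropic hrs)
  let C := Sp.ofSymm _ (symmSingle_transpose p s) (symmSingle_isotropic hps)
  have hqs := Omega_swap (R := R) q s
  have hqp := Omega_swap (R := R) q p
  have hrp := Omega_swap (R := R) r p
  have hsp := Omega_swap (R := R) s p
  have hrq := Omega_swap (R := R) r q
  rw [hsq, neg_zero] at hqs
  rw [hpq, neg_zero] at hqp
  rw [hpr, neg_zero] at hrp
  rw [hps, neg_zero] at hsp
  rw [hqr] at hrq
  have assoc : ∀ S T : Matrix (Fin m ⊕ Fin m) (Fin m ⊕ Fin m) R,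
      S * Omega m R * (T * Omega m R) = S * Omega m R * T * Omega m R := by
    intro S T; simp only [mul_assoc]
  have hXY : symmSingle R p q * Omega m R * (symmSingle R r s * Omega m R) =
      symmSingle R r s * Omega m R * (symmSingle R p q * Omega m R) +
        symmSingle R p s * Omega m R := by
    rw [assoc, assoc, ← add_mul, symmSingle_mul_Omega_mul_symmSingle,
      symmSingle_mul_Omega_mul_symmSingle, hqr, hqs, hpr, hps, hsp, hsq, hrp, hrq, symmSingle]
    simp [← Matrix.single_neg]
  have hZX : symmSingle R p s * Omega m R * (symmSingle R p q * Omega m R) = 0 := by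
    rw [assoc, symmSingle_mul_Omega_mul_symmSingle, hsp, hsq, hpq, Omega_self]
    simp
  have hXZ : symmSingle R p q * Omega m R * (symmSingle R p s * Omega m R) = 0 := by
    rw [assoc, symmSingle_mul_Omega_mul_symmSingle, hqp, hqs, hps, Omega_self]
    simp
  have hZY : symmSingle R p s * Omega m R * (symmSingle R r s * Omega m R) = 0 := by
    rw [assoc, symmSingle_mul_Omega_mul_symmSingle, hsr, hpr, hps, Omega_self]
    simp
  have hYZ : symmSingle R r s * Omega m R * (symmSingle R p s * Omega m R) = 0 := by
    rw [assoc, symmSingle_mul_Omega_mul_symmSingle, hsp, hrs, hrp, Omega_self]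
    simp
  have hAB : A * B = C * (B * A) := by
    apply Subtype.ext
    apply Units.ext
    change (1 + symmSingle R p q * Omega m R) * (1 + symmSingle R r s * Omega m R) =
      (1 + symmSingle R p s * Omega m R) * ((1 + symmSingle R r s * Omega m R) *
        (1 + symmSingle R p q * Omega m R))
    generalize symmSingle R p q * Omega m R = X at *
    generalize symmSingle R r s * Omega m R = Y at *
    generalize symmSingle R p s * Omega m R = Z at *
    simp only [mul_add, add_mul, one_mul, mul_one, ← mul_assoc, hXY, hZX, hZY, zero_mul]
    abel
  have hCA : Commute C A := by
    apply Subtype.ext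
    apply Units.ext
    change (1 + symmSingle R p s * Omega m R) * (1 + symmSingle R p q * Omega m R) =
      (1 + symmSingle R p q * Omega m R) * (1 + symmSingle R p s * Omega m R)
    rw [add_mul, mul_add, mul_add, hZX, add_mul, mul_add, mul_add, hXZ]
    simp only [one_mul, mul_one]
    abel
  have hCB : Commute C B := by
    apply Subtype.ext
    apply Units.ext
    change (1 + symmSingle R p s * Omega m R) * (1 + symmSingle R r s * Omega m R) =
      (1 + symmSingle R r s * Omega m R) * (1 + symmSingle R p s * Omega m R)
    rw [add_mul, mul_add, mul_add, hZY, add_mul, mul_add, mul_add, hYZ]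
    simp only [one_mul, mul_one]
    abel
  obtain ⟨N, hN0, hN, g, hg, h, hh, hgh⟩ :=
    Γ.exists_mul_eq_pow_mul_of_heisenberg hΓ hAB hCA hCB
  refine ⟨N, hN0, hN, fun w hw => ?_⟩
  have hu := hinv _ (Γ.inv_mem (Γ.mul_mem hh hg)) w hw
  have h1 := habel g hg h hh _ hu
  have hmul : ∀ (x y : Sp m R) (v : Fin m ⊕ Fin m → R),
      ((x * y : Sp m R) : GL (Fin m ⊕ Fin m) R).val.mulVec v =
        x.val.val.mulVec (y.val.val.mulVec v) := by
    intro x y v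
    rw [Matrix.mulVec_mulVec]
    rfl
  rw [hgh, ← hmul, ← hmul, mul_assoc, mul_inv_cancel, mul_one, Sp.coe_ofSymm_pow,
    Matrix.add_mulVec, Matrix.smul_mulVec] at h1
  have h2 : ((1 : Sp m R) : GL (Fin m ⊕ Fin m) R).val = 1 := rfl
  simpa [h2] using h1

/-- Obtained from commuting powers of two non-commuting symplectic transvections in `Γ`. -/
theorem exists_le_index_sq_smul_eq_zero {m : ℕ} {R : Type*} [CommRing R]
    (Γ : Subgroup (Sp m R)) (hΓ : Γ.index ≠ 0) (W : Submodule R (Fin m ⊕ Fin m → R))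
    (habel : ∀ A ∈ Γ, ∀ B ∈ Γ, ∀ w ∈ W,
      ((A * B : Sp m R) : GL (Fin m ⊕ Fin m) R).val.mulVec w =
      ((B * A : Sp m R) : GL (Fin m ⊕ Fin m) R).val.mulVec w) (i : Fin m ⊕ Fin m) :
    ∃ N, 0 < N ∧ N ≤ Γ.index ^ 2 ∧ ∀ w ∈ W, N • w i = 0 := by
  have iso : ∀ p : Fin m ⊕ Fin m,
      Matrix.single p p (1 : R) * Omega m R * Matrix.single p p 1 = 0 := by
    intro p
    simp [Omega_self]
  have tr : ∀ p : Fin m ⊕ Fin m,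
      (Matrix.single p p (1 : R))ᵀ = Matrix.single p p 1 := by
    intro p
    simp
  obtain ⟨a, ha0, ha, haΓ⟩ :=
    Γ.exists_pow_mem_of_index_ne_zero hΓ (Sp.ofSymm _ (tr i.swap) (iso i.swap))
  obtain ⟨b, hb0, hb, hbΓ⟩ :=
    Γ.exists_pow_mem_of_index_ne_zero hΓ (Sp.ofSymm _ (tr i) (iso i))
  refine ⟨a * b, Nat.mul_pos ha0 hb0, by rw [sq]; exact Nat.mul_le_mul ha hb, fun w hw => ?_⟩
  have h1 := habel _ haΓ _ hbΓ w hw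
  simp only [Subgroup.coe_mul, Units.val_mul] at h1
  rw [Sp.coe_ofSymm_pow, Sp.coe_ofSymm_pow] at h1
  have hi : i ≠ i.swap := by rcases i with i | i <;> simp
  have hΩ : Omega m R i i.swap = 1 ∨ Omega m R i i.swap = -1 := by
    rcases i with i | i <;> simp [Omega]
  have hs1 : (Matrix.single i.swap i.swap (1 : R) * Omega m R) i i = 0 :=
    Matrix.single_mul_apply_of_ne _ _ _ _ _ hi _
  have hs2 : (Matrix.single i i (1 : R) * Omega m R) i i.swap = Omega m R i i.swap := by
    rw [Matrix.single_mul_apply_same, one_mul]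
  have h2 := congrFun h1 i
  simp only [add_mul, mul_add, one_mul, mul_one, smul_mul_assoc, mul_smul_comm,
    Matrix.add_mulVec, Matrix.one_mulVec, Matrix.smul_mulVec, ← Matrix.mulVec_mulVec,
    Matrix.single_mulVec_eq, Matrix.mulVec_smul, Matrix.mulVec_single_one, Pi.add_apply,
    Pi.smul_apply, Pi.single_apply, if_neg hi, if_true, Matrix.col_apply, smul_eq_mul,
    mul_zero, smul_zero, add_zero, hs1, hs2] at h2
  simp only [nsmul_eq_mul] at h2
  have h3 : (a : R) * b * ((Omega m R *ᵥ w) i.swap * Omega m R i i.swap) = 0 := by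
    linear_combination -h2
  rw [nsmul_eq_mul, Nat.cast_mul]
  rcases hΩ with h | h <;> rcases Omega_mulVec_swap i w with h' | h' <;>
    rw [h, h'] at h3 <;> simpa using h3

theorem natCard_submodule_le_of_nsmul_eq_zero {ι : Type*} [Finite ι] {n : ℕ} [NeZero n]
    (W : Submodule (ZMod n) (ι → ZMod n)) {d : ℕ} (hd : 0 < d)
    (h : ∀ w ∈ W, ∀ i, d • w i = 0) : Nat.card W ≤ d ^ Nat.card ι := by
  classical
  have hT : Nat.card {x : ZMod n // d • x = 0} ≤ d := by
    rw [Nat.card_eq_fintype_card, Fintype.card_subtype]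
    exact IsAddCyclic.card_nsmul_eq_zero_le hd
  let f : W → ι → {x : ZMod n // d • x = 0} := fun w i => ⟨w.1 i, h w.1 w.2 i⟩
  have hf : Function.Injective f := by
    intro v w hvw
    ext i
    exact congrArg Subtype.val (congrFun hvw i)
  calc Nat.card W ≤ Nat.card (ι → {x : ZMod n // d • x = 0}) :=
        Nat.card_le_card_of_injective f hf
    _ = Nat.card {x : ZMod n // d • x = 0} ^ Nat.card ι := Nat.card_fun
    _ ≤ d ^ Nat.card ι := Nat.pow_le_pow_left hT _

theorem exists_addOrderOf_eq_prime_pow_and_natCard_le {ι : Type*} [Finite ι] [Nonempty ι]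
    {l e : ℕ} (hl : l.Prime) (W : Submodule (ZMod (l ^ e)) (ι → ZMod (l ^ e))) :
    ∃ w ∈ W, ∃ i, ∃ k, addOrderOf (w i) = l ^ k ∧ Nat.card W ≤ (l ^ k) ^ Nat.card ι := by
  have : NeZero (l ^ e) := ⟨pow_ne_zero _ hl.ne_zero⟩
  have hpow : ∀ x : ZMod (l ^ e), ∃ k, addOrderOf x = l ^ k := by
    intro x
    have h : addOrderOf x ∣ l ^ e := by
      rw [addOrderOf_dvd_iff_nsmul_eq_zero, nsmul_eq_mul, ZMod.natCast_self, zero_mul]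
    obtain ⟨k, -, hk⟩ := (Nat.dvd_prime_pow hl).1 h
    exact ⟨k, hk⟩
  obtain ⟨⟨w, i⟩, hmax⟩ := Finite.exists_max (fun x : W × ι => addOrderOf (x.1.1 x.2))
  obtain ⟨k, hk⟩ := hpow (w.1 i)
  refine ⟨w, w.2, i, k, hk, natCard_submodule_le_of_nsmul_eq_zero W (pow_pos hl.pos k) ?_⟩
  intro v hv j
  obtain ⟨k', hk'⟩ := hpow (v j)
  have h := hmax (⟨v, hv⟩, j)
  simp only [hk, hk'] at h
  rw [← addOrderOf_dvd_iff_nsmul_eq_zero, hk']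
  exact pow_dvd_pow _ ((Nat.pow_le_pow_iff_right hl.one_lt).1 h)

theorem prod_one_sub_inv_pow_mem_Icc {l : ℕ} (hl : 1 ≤ l) (m : ℕ) :
    ∏ i ∈ Finset.Icc 1 m, (1 - ((l : ℝ) ^ (2 * i))⁻¹) ∈ Set.Icc (0 : ℝ) 1 := by
  have h : ∀ i : ℕ, ((l : ℝ) ^ (2 * i))⁻¹ ≤ 1 := fun i =>
    inv_le_one_of_one_le₀ (one_le_pow₀ (by exact_mod_cast hl))
  exact ⟨Finset.prod_nonneg fun i _ => sub_nonneg.2 (h i),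
    Finset.prod_le_one (fun i _ => sub_nonneg.2 (h i))
      fun i _ => sub_le_self _ (by positivity)⟩

theorem pow_mul_prod_pow_le {l : ℕ} (hl : l.Prime) {m k I : ℕ} (hm : 1 ≤ m)
    (hI : I ≠ 0) (hsq : l ^ k ≤ I ^ 2) (hlt : m ≠ 1 → l ^ k ≤ I ∨ l = 2 ∧ m = 2 ∧ l ^ k ≤ 2 * I) :
    ((l ^ k : ℕ) : ℝ) ^ (2 * m) *
      (∏ i ∈ Finset.Icc 1 m, (1 - ((l : ℝ) ^ (2 * i))⁻¹)) ^ (2 + 2 * m) ≤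
        (I : ℝ) ^ (2 + 2 * m) := by
  obtain ⟨hP0, hP1⟩ := prod_one_sub_inv_pow_mem_Icc hl.one_le m
  have hd : 1 ≤ l ^ k := Nat.one_le_pow _ _ hl.pos
  have hle : l ^ k ≤ I → ((l ^ k : ℕ) : ℝ) ^ (2 * m) *
      (∏ i ∈ Finset.Icc 1 m, (1 - ((l : ℝ) ^ (2 * i))⁻¹)) ^ (2 + 2 * m) ≤
        (I : ℝ) ^ (2 + 2 * m) := by
    intro h
    calc _ ≤ ((l ^ k : ℕ) : ℝ) ^ (2 * m) :=
          mul_le_of_le_one_right (by positivity) (pow_le_one₀ hP0 hP1)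
      _ ≤ (I : ℝ) ^ (2 * m) := by gcongr
      _ ≤ (I : ℝ) ^ (2 + 2 * m) :=
          pow_le_pow_right₀ (by exact_mod_cast Nat.one_le_iff_ne_zero.2 hI) (by omega)
  rcases eq_or_ne m 1 with rfl | hm1
  · calc _ ≤ ((l ^ k : ℕ) : ℝ) ^ (2 * 1) :=
          mul_le_of_le_one_right (by positivity) (pow_le_one₀ hP0 hP1)
      _ ≤ ((I ^ 2 : ℕ) : ℝ) ^ (2 * 1) := by gcongr
      _ = (I : ℝ) ^ (2 + 2 * 1) := by push_cast; ring
  · rcases hlt hm1 with h | ⟨rfl, rfl, h⟩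
    · exact hle h
    · rcases Nat.lt_or_ge k 2 with hk | hk
      · apply hle
        interval_cases k
        · exact Nat.one_le_iff_ne_zero.2 hI
        · by_contra! hlt
          have : I = 1 := by omega
          subst this
          norm_num at hsq
      · have h4 : (4 : ℝ) ≤ ((2 ^ k : ℕ) : ℝ) := by
          exact_mod_cast Nat.pow_le_pow_right (n := 2) (by norm_num) hk
        have hh : ((2 ^ k : ℕ) : ℝ) ≤ 2 * I := by exact_mod_cast h
        generalize ((2 ^ k : ℕ) : ℝ) = d at h4 hh
        have hP : (∏ i ∈ Finset.Icc 1 2, (1 - (((2 : ℕ) : ℝ) ^ (2 * i))⁻¹)) = 45 / 64 := by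
          rw [Finset.prod_Icc_succ_top (by norm_num)]
          norm_num
        rw [hP]
        calc d ^ (2 * 2) * (45 / 64) ^ (2 + 2 * 2) ≤ d ^ 4 * (4 ^ 2 / 64) := by
              refine mul_le_mul_of_nonneg_left ?_ (by positivity)
              norm_num
          _ ≤ d ^ 4 * (d ^ 2 / 64) := by gcongr
          _ = (d / 2) ^ 6 := by ring
          _ ≤ (I : ℝ) ^ 6 := by
              gcongr
              linarith
          _ = _ := by norm_num

theorem symmSingle_mul_Omega_mulVec_apply {m : ℕ} {R : Type*} [CommRing R]
    (p s : Fin m ⊕ Fin m) (w : Fin m ⊕ Fin m → R) :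
    ((symmSingle R p s * Omega m R) *ᵥ w) s =
      (if s = p then (Omega m R *ᵥ w) s else 0) + (Omega m R *ᵥ w) p := by
  simp only [symmSingle, add_mul, Matrix.add_mulVec, ← Matrix.mulVec_mulVec,
    Matrix.single_mulVec_eq, Pi.add_apply, Pi.smul_apply, Pi.single_apply, one_mul, smul_eq_mul,
    mul_ite, mul_one, mul_zero, if_true]

theorem exists_le_index_two_mul_smul_eq_zero {m : ℕ} {R : Type*} [CommRing R]
    (Γ : Subgroup (Sp m R)) (hΓ : Γ.index ≠ 0) (W : Submodule R (Fin m ⊕ Fin m → R))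
    (hinv : ∀ g ∈ Γ, ∀ w ∈ W, (g : Sp m R).val.val.mulVec w ∈ W)
    (habel : ∀ A ∈ Γ, ∀ B ∈ Γ, ∀ w ∈ W,
      ((A * B : Sp m R) : GL (Fin m ⊕ Fin m) R).val.mulVec w =
      ((B * A : Sp m R) : GL (Fin m ⊕ Fin m) R).val.mulVec w)
    (hm : 2 ≤ m) (i : Fin m ⊕ Fin m) :
    ∃ N, 0 < N ∧ N ≤ Γ.index ∧ ∀ w ∈ W, (2 * N) • w i = 0 := by
  obtain ⟨j, -, hj⟩ := Finset.exists_mem_notMem_of_card_lt_card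
    (s := {Sum.elim id id i}) (t := (Finset.univ : Finset (Fin m))) (by simp; omega)
  rw [Finset.mem_singleton] at hj
  obtain ⟨N, hN0, hN, h⟩ := exists_le_index_smul_symmSingle_mulVec_eq_zero Γ hΓ W hinv habel
    (p := i.swap) (s := i.swap) (q := Sum.inl j) (r := Sum.inr j)
    (by simp [Omega]) (Omega_self _)
    (by rcases i with i | i <;> simp_all [Omega, eq_comm])
    (by rcases i with i | i <;> simp_all [Omega, eq_comm])
    (by rcases i with i | i <;> simp_all [Omega, eq_comm])
    (by rcases i with i | i <;> simp_all [Omega, eq_comm])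
  refine ⟨N, hN0, hN, fun w hw => ?_⟩
  have h1 := congrFun (h w hw) i.swap
  rw [Pi.smul_apply, symmSingle_mul_Omega_mulVec_apply, if_pos rfl, ← two_nsmul, ← mul_nsmul,
    Pi.zero_apply] at h1
  rcases Omega_mulVec_swap i w with h' | h' <;> rw [h'] at h1
  · exact h1
  · simpa only [smul_neg, neg_eq_zero] using h1

theorem exists_le_index_smul_eq_zero {m : ℕ} {R : Type*} [CommRing R]
    (Γ : Subgroup (Sp m R)) (hΓ : Γ.index ≠ 0) (W : Submodule R (Fin m ⊕ Fin m → R))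
    (hinv : ∀ g ∈ Γ, ∀ w ∈ W, (g : Sp m R).val.val.mulVec w ∈ W)
    (habel : ∀ A ∈ Γ, ∀ B ∈ Γ, ∀ w ∈ W,
      ((A * B : Sp m R) : GL (Fin m ⊕ Fin m) R).val.mulVec w =
      ((B * A : Sp m R) : GL (Fin m ⊕ Fin m) R).val.mulVec w)
    (hm : 3 ≤ m) (i : Fin m ⊕ Fin m) :
    ∃ N, 0 < N ∧ N ≤ Γ.index ∧ ∀ w ∈ W, N • w i = 0 := by
  obtain ⟨k, -, hk⟩ := Finset.exists_mem_notMem_of_card_lt_card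
    (s := {Sum.elim id id i}) (t := (Finset.univ : Finset (Fin m))) (by simp; omega)
  obtain ⟨j, -, hj⟩ := Finset.exists_mem_notMem_of_card_lt_card
    (s := {Sum.elim id id i, k}) (t := (Finset.univ : Finset (Fin m)))
    (Finset.card_le_two.trans_lt (by simp; omega))
  rw [Finset.mem_singleton] at hk
  rw [Finset.mem_insert, Finset.mem_singleton, not_or] at hj
  obtain ⟨hj, hjk⟩ := hj
  obtain ⟨N, hN0, hN, h⟩ := exists_le_index_smul_symmSingle_mulVec_eq_zero Γ hΓ W hinv habel
    (p := i.swap) (s := Sum.inl k) (q := Sum.inl j) (r := Sum.inr j)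
    (by simp [Omega])
    (by rcases i with i | i <;> simp_all [Omega, eq_comm])
    (by rcases i with i | i <;> simp_all [Omega, eq_comm])
    (by rcases i with i | i <;> simp_all [Omega, eq_comm])
    (by simp [Omega]) (by simp [Omega, Ne.symm hjk])
  have hki : (Sum.inl k : Fin m ⊕ Fin m) ≠ i.swap := by
    rcases i with i | i <;> simp_all
  refine ⟨N, hN0, hN, fun w hw => ?_⟩
  have h1 := congrFun (h w hw) (Sum.inl k)
  rw [Pi.smul_apply, symmSingle_mul_Omega_mulVec_apply, if_neg hki, zero_add,
    Pi.zero_apply] at h1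
  rcases Omega_mulVec_swap i w with h' | h' <;> rw [h'] at h1
  · exact h1
  · simpa only [smul_neg, neg_eq_zero] using h1

/-- **Prime-power case of the symplectic estimate.** For `n = l^e` a prime power,
if `Γ ≤ Sp(2m, ℤ/nℤ)` acts abelianly on a `Γ`-invariant submodule `W` of `(ℤ/nℤ)^(2m)`,
then `I(Γ)^(2 + 2m) ≥ |W| · (∏_{i=1}^m (1 - l^{-2i}))^(2 + 2m)`. -/
theorem index_rpow_ge_card_mul_of_abelian_action_Sp_primePow
    (l : ℕ) (hl : l.Prime) (e m : ℕ) (he : 1 ≤ e) (hm : 1 ≤ m)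
    (Γ : Subgroup (Sp m (ZMod (l ^ e))))
    (W : Submodule (ZMod (l ^ e)) (Fin m ⊕ Fin m → ZMod (l ^ e)))
    (hinv : ∀ g ∈ Γ, ∀ w ∈ W, (g : Sp m (ZMod (l ^ e))).val.val.mulVec w ∈ W)
    (habel : ∀ A ∈ Γ, ∀ B ∈ Γ, ∀ w ∈ W,
      ((A * B : Sp m (ZMod (l ^ e))) : GL (Fin m ⊕ Fin m) (ZMod (l ^ e))).val.mulVec w =
      ((B * A : Sp m (ZMod (l ^ e))) : GL (Fin m ⊕ Fin m) (ZMod (l ^ e))).val.mulVec w) :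
    (Γ.index : ℝ) ^ ((2 : ℝ) + 2 * (m : ℝ)) ≥
      (Nat.card W : ℝ) *
        (∏ i ∈ Finset.Icc 1 m, (1 - ((l : ℝ) ^ (2 * i))⁻¹)) ^ ((2 : ℝ) + 2 * (m : ℝ)) := by
  have : NeZero (l ^ e) := ⟨pow_ne_zero _ hl.ne_zero⟩
  have : Nonempty (Fin m ⊕ Fin m) := ⟨Sum.inl ⟨0, hm⟩⟩
  have hΓ : Γ.index ≠ 0 := Subgroup.index_ne_zero_of_finite
  obtain ⟨w, hw, i, k, hk, hcard⟩ := exists_addOrderOf_eq_prime_pow_and_natCard_le hl W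
  rw [Nat.card_sum, Nat.card_fin, ← two_mul] at hcard
  have hle : ∀ {N : ℕ}, 0 < N → N • w i = 0 → l ^ k ≤ N := fun hN h =>
    hk ▸ Nat.le_of_dvd hN (addOrderOf_dvd_iff_nsmul_eq_zero.2 h)
  obtain ⟨M, hM0, hM, hMw⟩ := exists_le_index_sq_smul_eq_zero Γ hΓ W habel i
  have hlt : m ≠ 1 → l ^ k ≤ Γ.index ∨ l = 2 ∧ m = 2 ∧ l ^ k ≤ 2 * Γ.index := by
    intro hm1
    rcases eq_or_ne m 2 with hm2 | hm2
    · obtain ⟨N, hN0, hN, hNw⟩ :=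
        exists_le_index_two_mul_smul_eq_zero Γ hΓ W hinv habel hm2.ge i
      rcases eq_or_ne l 2 with hl2 | hl2
      · exact Or.inr ⟨hl2, hm2, (hle (by omega) (hNw w hw)).trans (by omega)⟩
      · left
        have hdvd : l ^ k ∣ 2 * N := hk ▸ addOrderOf_dvd_iff_nsmul_eq_zero.2 (hNw w hw)
        have hcop : Nat.Coprime (l ^ k) 2 :=
          ((Nat.coprime_primes hl Nat.prime_two).2 hl2).pow_left k
        exact (Nat.le_of_dvd hN0 (hcop.dvd_of_dvd_mul_left hdvd)).trans hN
    · obtain ⟨N, hN0, hN, hNw⟩ :=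
        exists_le_index_smul_eq_zero Γ hΓ W hinv habel (by omega) i
      exact Or.inl ((hle hN0 (hNw w hw)).trans hN)
  have hexp : (2 : ℝ) + 2 * (m : ℝ) = ((2 + 2 * m : ℕ) : ℝ) := by push_cast; ring
  rw [hexp, Real.rpow_natCast, Real.rpow_natCast, ge_iff_le]
  have hP0 := (prod_one_sub_inv_pow_mem_Icc hl.one_le m).1
  refine le_trans ?_ (pow_mul_prod_pow_le hl hm hΓ ((hle hM0 (hMw w hw)).trans hM) hlt)
  gcongr
  exact_mod_cast hcard
end

section
/- Let l be a prime and e ≥ 1, m ≥ 1 integers. The cardinality of the general linear group GL_m(ZMod l^e) equals l^(m²·e) · ∏_{k=1}^{m} (1 - l^{-k}), i.e. |GL_m(ZMod l^e)| = l^(m²(e-1)) · ∏_{k=1}^{m} (l^m - l^{m-k}) as natural numbers. -/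
/-- A surjective local homomorphism of rings `f : A → B` restricts to a surjection `Aˣ → Bˣ`
whose kernel `1 + ker f` is in bijection with `ker f`. -/
theorem card_units_mul_card_of_surjective {A B : Type*} [Ring A] [Ring B] (f : A →+* B)
    [IsLocalHom f] (hf : Function.Surjective f) :
    Nat.card Aˣ * Nat.card B = Nat.card Bˣ * Nat.card A := by
  have hu : Function.Surjective (Units.map (f : A →* B)) := by
    intro b
    obtain ⟨a, ha⟩ := hf b
    have h : IsUnit a := isUnit_of_map_unit f a (ha ▸ b.isUnit)
    exact ⟨h.unit, Units.ext ha⟩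
  have hker : Nat.card (Units.map (f : A →* B)).ker = Nat.card (f : A →+ B).ker := by
    refine Nat.card_eq_of_bijective
      (fun u => ⟨(u.1 : A) - 1, ?_⟩) ⟨?_, ?_⟩
    · have h : f (u.1 : A) = 1 := congrArg Units.val u.2
      simp [AddMonoidHom.mem_ker, h]
    · intro u v h
      exact Subtype.ext (Units.ext (sub_left_injective (congrArg Subtype.val h)))
    · rintro ⟨x, hx⟩
      have hx' : f (x + 1) = 1 := by
        have : f x = 0 := hx
        simp [this]
      have h : IsUnit (x + 1) := isUnit_of_map_unit f _ (hx' ▸ isUnit_one)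
      exact ⟨⟨h.unit, Units.ext hx'⟩, Subtype.ext (add_sub_cancel_right x 1)⟩
  have h₁ := (Units.map (f : A →* B)).ker.card_mul_index
  have h₂ := (f : A →+ B).ker.card_mul_index
  rw [Subgroup.index_ker, MonoidHom.range_eq_top.2 hu, Subgroup.card_top, hker] at h₁
  rw [AddSubgroup.index_ker, AddMonoidHom.range_eq_top.2 hf, AddSubgroup.card_top] at h₂
  rw [← h₁, ← h₂]
  ring

theorem isLocalHom_mapMatrix {n R S : Type*} [Fintype n] [DecidableEq n] [CommRing R]
    [CommRing S] (f : R →+* S) [IsLocalHom f] :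
    IsLocalHom (f.mapMatrix : Matrix n n R →+* Matrix n n S) where
  map_nonunit a h := by
    rw [Matrix.isUnit_iff_isUnit_det, ← RingHom.map_det] at h
    exact (Matrix.isUnit_iff_isUnit_det a).2 (isUnit_of_map_unit f _ h)

theorem isLocalHom_castHom_primePow {l e : ℕ} (hl : l.Prime) (he : l ∣ l ^ e) :
    IsLocalHom (ZMod.castHom he (ZMod l)) where
  map_nonunit a h := by
    have : NeZero (l ^ e) := ⟨pow_ne_zero _ hl.ne_zero⟩
    obtain ⟨k, rfl⟩ := ZMod.natCast_zmod_surjective a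
    rw [map_natCast, ZMod.isUnit_iff_coprime] at h
    exact (ZMod.isUnit_iff_coprime k _).2 (h.pow_right e)

/-- **Order of the general linear group over `ℤ/l^eℤ`.**
`|GL_m(ℤ/l^eℤ)| = l^(m²(e-1)) · ∏_{k=1}^m (l^m - l^(m-k))`
(equivalently, `l^(m²e) · ∏_{k=1}^m (1 - l^{-k})`). -/
theorem card_GL_zmod_primePow (l : ℕ) (hl : l.Prime) (e m : ℕ) (he : 1 ≤ e) (hm : 1 ≤ m) :
    Nat.card (GL (Fin m) (ZMod (l ^ e))) =
      l ^ (m ^ 2 * (e - 1)) * ∏ k ∈ Finset.Icc 1 m, (l ^ m - l ^ (m - k)) := by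
  have : Fact l.Prime := ⟨hl⟩
  have hdvd : l ∣ l ^ e := dvd_pow_self l (by lia)
  have hloc := isLocalHom_castHom_primePow hl hdvd
  have hlocM := isLocalHom_mapMatrix (n := Fin m) (ZMod.castHom hdvd (ZMod l))
  have hsurj : Function.Surjective
      ((ZMod.castHom hdvd (ZMod l)).mapMatrix (m := Fin m)) := by
    intro M
    choose g hg using ZMod.castHom_surjective hdvd
    exact ⟨M.map g, Matrix.ext fun i j => hg (M i j)⟩
  have hcard := card_units_mul_card_of_surjective _ hsurj
  have hmat (q : ℕ) : Nat.card (Matrix (Fin m) (Fin m) (ZMod q)) = q ^ (m ^ 2) := by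
    simp [Matrix, Nat.card_fun, ← pow_mul, sq]
  have hprod : ∏ i : Fin m, (l ^ m - l ^ (i : ℕ)) =
      ∏ k ∈ Finset.Icc 1 m, (l ^ m - l ^ (m - k)) := by
    rw [Fin.prod_univ_eq_prod_range (fun i => l ^ m - l ^ i) m]
    refine Finset.prod_bij' (fun i _ => m - i) (fun k _ => m - k) ?_ ?_ ?_ ?_ ?_ <;>
      simp only [Finset.mem_range, Finset.mem_Icc] <;> intro i hi
    · lia
    · lia
    · lia
    · lia
    · rw [Nat.sub_sub_self hi.le]
  have hfield : Nat.card (Matrix (Fin m) (Fin m) (ZMod l))ˣ =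
      ∏ i : Fin m, (l ^ m - l ^ (i : ℕ)) := by
    simpa using Matrix.card_GL_field (𝔽 := ZMod l) m
  rw [hmat, hmat, hfield, hprod] at hcard
  refine Nat.eq_of_mul_eq_mul_right (pow_pos hl.pos (m ^ 2)) (hcard.trans ?_)
  obtain ⟨d, rfl⟩ := Nat.exists_eq_add_of_le' he
  rw [Nat.add_sub_cancel]
  ring
end

section
/- Let p be a prime and n ≥ 1, k ≥ 1 integers. The cardinality of the symplectic group Sp(2n, ZMod p^k) equals p^(k(2n² + n)) · ∏_{i=1}^{n} (1 - p^{-2i}), i.e. |Sp(2n, ZMod p^k)| = p^((2k-1)n² + (k-1)n) · ∏_{i=1}^{n} (p^{2i} - 1) as natural numbers. -/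
open Matrix

section SymplecticFrames

variable {R V : Type*} [CommRing R] [AddCommGroup V] [Module R V]

/-- Pairs of `n`-tuples `(v, w)` in `V` satisfying the relations of a symplectic basis for `B`. -/
abbrev SymplecticFrame (B : LinearMap.BilinForm R V) (n : ℕ) : Type _ :=
  {x : (Fin n → V) × (Fin n → V) // ∀ i j, B (x.1 i) (x.1 j) = 0 ∧ B (x.2 i) (x.2 j) = 0 ∧
    B (x.1 i) (x.2 j) = if i = j then 1 else 0}

/-- Pairs `(v, w)` with `B v w = 1`. -/
abbrev HyperbolicPair (B : LinearMap.BilinForm R V) : Type _ :=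
  {x : V × V // B x.1 x.2 = 1}

/-- The orthogonal complement of the span of `v` and `w`. -/
def orthogonalPair (B : LinearMap.BilinForm R V) (v w : V) : Submodule R V :=
  LinearMap.ker (B v) ⊓ LinearMap.ker (B w)

lemma mem_orthogonalPair {B : LinearMap.BilinForm R V} {v w x : V} :
    x ∈ orthogonalPair B v w ↔ B v x = 0 ∧ B w x = 0 := by
  simp [orthogonalPair]

/-- A hyperbolic pair splits off as an orthogonal direct summand. -/
def hyperbolicSplitting (B : LinearMap.BilinForm R V) (hB : B.IsAlt) {v w : V}
    (h : B v w = 1) : V ≃ₗ[R] R × R × orthogonalPair B v w where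
  toFun x := (B x w, B v x, ⟨x - B x w • v - B v x • w, by
    have h' : B w v = -1 := by rw [← hB.neg_eq v w, h]
    have hx : B w x = - B x w := (hB.neg_eq x w).symm
    rw [mem_orthogonalPair]
    simp [h, h', hx, hB.self_eq_zero]⟩)
  map_add' x y := by
    ext <;> simp
    module
  map_smul' c x := by
    ext <;> simp
    module
  invFun y := y.1 • v + y.2.1 • w + y.2.2
  left_inv x := by simp
  right_inv := by
    rintro ⟨a, b, u, hu⟩
    obtain ⟨h₁, h₂⟩ := mem_orthogonalPair.1 hu
    have h₃ : B u w = 0 := by rw [← hB.neg_eq w u, h₂, neg_zero]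
    ext <;> simp [h, h₁, h₃, hB.self_eq_zero]
    abel

/-- A symplectic frame consists of its first pair and a frame of the complement of that pair. -/
def symplecticFrameSuccEquiv (B : LinearMap.BilinForm R V) (hB : B.IsAlt) (n : ℕ) :
    SymplecticFrame B (n + 1) ≃
      Σ x : HyperbolicPair B,
        SymplecticFrame (B.restrict (orthogonalPair B x.1.1 x.1.2)) n where
  toFun f := ⟨⟨(f.1.1 0, f.1.2 0), by simpa using (f.2 0 0).2.2⟩,
    ⟨(fun i => ⟨f.1.1 i.succ, mem_orthogonalPair.2 ⟨(f.2 0 i.succ).1, by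
        rw [← hB.neg_eq, (f.2 i.succ 0).2.2]; simp⟩⟩,
      fun i => ⟨f.1.2 i.succ, mem_orthogonalPair.2 ⟨by
        rw [(f.2 0 i.succ).2.2]; simp [(Fin.succ_ne_zero i).symm], (f.2 0 i.succ).2.1⟩⟩),
      fun i j => by simpa using f.2 i.succ j.succ⟩⟩
  invFun y := ⟨(Fin.cons y.1.1.1 fun i => (y.2.1.1 i : V),
      Fin.cons y.1.1.2 fun i => (y.2.1.2 i : V)), by
    obtain ⟨⟨⟨v, w⟩, h⟩, ⟨⟨f, g⟩, hfg⟩⟩ := y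
    have hf i := mem_orthogonalPair.1 (f i).2
    have hg i := mem_orthogonalPair.1 (g i).2
    have hf' i : B (f i) v = 0 ∧ B (f i) w = 0 := by
      rw [← hB.neg_eq v, ← hB.neg_eq w]; simpa using hf i
    have hg' i : B (g i) v = 0 ∧ B (g i) w = 0 := by
      rw [← hB.neg_eq v, ← hB.neg_eq w]; simpa using hg i
    simp only at h hf hg
    simp only [LinearMap.BilinForm.restrict_apply, LinearMap.domRestrict_apply] at hfg
    intro i j
    refine Fin.cases ?_ (fun i => ?_) i <;> refine Fin.cases ?_ (fun j => ?_) j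
    · simp [h, hB.self_eq_zero]
    · simp [hf, hg, (Fin.succ_ne_zero j).symm]
    · simp [hf', hg']
    · simpa using hfg i j⟩
  left_inv f := by
    apply Subtype.ext
    refine Prod.ext ?_ ?_ <;> funext i <;> refine Fin.cases ?_ (fun i => ?_) i <;> rfl
  right_inv _ := rfl

lemma exists_apply_eq_one_iff {B : LinearMap.BilinForm R V}
    (hnd : ∀ x, (∀ y, B x y = 0) → x = 0) {t : R} (ht : ∀ a : R, t * a = 0 ↔ ¬ IsUnit a) (v : V) :
    (∃ w, B v w = 1) ↔ ¬ t • v = 0 := by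
  constructor
  · rintro ⟨w, hw⟩ h
    have h' : B (t • v) w = 0 := by simp [h]
    rw [map_smul, LinearMap.smul_apply, hw, smul_eq_mul] at h'
    exact (ht 1).1 h' isUnit_one
  · intro h
    by_contra! hv
    refine h (hnd _ fun y => ?_)
    rw [map_smul, LinearMap.smul_apply, smul_eq_mul, ht]
    rintro ⟨u, hu⟩
    exact hv ((↑u⁻¹ : R) • y) (by simp [← hu])

lemma card_apply_eq_one_mul_card [Finite V] (B : LinearMap.BilinForm R V) {v : V}
    (hv : ∃ w, B v w = 1) :
    Nat.card {w // B v w = 1} * Nat.card R = Nat.card V := by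
  obtain ⟨w₀, h₀⟩ := hv
  rw [← Nat.card_prod]
  refine Nat.card_congr
    { toFun := fun x => x.1.1 + (x.2 - 1) • w₀
      invFun := fun x => (⟨x + (1 - B v x) • w₀, by simp [h₀]⟩, B v x)
      left_inv := ?_
      right_inv := ?_ }
  · rintro ⟨⟨w, hw⟩, a⟩
    simp only [map_add, map_smul, hw, h₀, Prod.mk.injEq, Subtype.mk.injEq, smul_eq_mul]
    constructor
    · module
    · ring
  · intro x
    module

lemma card_hyperbolicPair_mul_card [Finite V] {B : LinearMap.BilinForm R V}
    (hnd : ∀ x, (∀ y, B x y = 0) → x = 0) {t : R} (ht : ∀ a : R, t * a = 0 ↔ ¬ IsUnit a) :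
    Nat.card (HyperbolicPair B) * Nat.card R =
      (Nat.card V - Nat.card {x : V // t • x = 0}) * Nat.card V := by
  classical
  have := Fintype.ofFinite V
  let e : HyperbolicPair B ≃ Σ v : {v : V // ¬ t • v = 0}, {w // B v w = 1} :=
    { toFun := fun x => ⟨⟨x.1.1, (exists_apply_eq_one_iff hnd ht _).1 ⟨_, x.2⟩⟩, ⟨x.1.2, x.2⟩⟩
      invFun := fun y => ⟨(y.1.1, y.2.1), y.2.2⟩
      left_inv := fun _ => rfl
      right_inv := fun _ => rfl }
  rw [Nat.card_congr e, Nat.card_sigma, Finset.sum_mul, Finset.sum_congr rfl fun v _ =>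
    card_apply_eq_one_mul_card B ((exists_apply_eq_one_iff hnd ht _).2 v.2)]
  simp [Fintype.card_subtype_compl]

theorem card_symplecticFrame [Finite R] {t : R} (ht : ∀ a : R, t * a = 0 ↔ ¬ IsUnit a) (n : ℕ) :
    ∀ {V : Type*} [AddCommGroup V] [Module R V] [Finite V] (B : LinearMap.BilinForm R V),
      B.IsAlt → (∀ x, (∀ y, B x y = 0) → x = 0) →
      Nat.card V = Nat.card R ^ (2 * n) →
      Nat.card {x : V // t • x = 0} = Nat.card {a : R // t * a = 0} ^ (2 * n) →
      Nat.card (SymplecticFrame B n) = ∏ i ∈ Finset.Icc 1 n, Nat.card R ^ (2 * i - 1) *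
        (Nat.card R ^ (2 * i) - Nat.card {a : R // t * a = 0} ^ (2 * i)) := by
  have hR : 0 < Nat.card R := Nat.card_pos
  have hr : 0 < Nat.card {a : R // t * a = 0} :=
    have : Nonempty {a : R // t * a = 0} := ⟨⟨0, mul_zero t⟩⟩
    Nat.card_pos
  induction n with
  | zero =>
    intro V _ _ _ B _ _ _ _
    have : Unique (SymplecticFrame B 0) :=
      { default := ⟨(Fin.elim0, Fin.elim0), fun i => i.elim0⟩
        uniq := fun _ => Subtype.ext (Subsingleton.elim _ _) }
    simp
  | succ n ih =>
    intro V _ _ _ B hB hnd hV hVt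
    have key (x : HyperbolicPair B) := by
      let W := orthogonalPair B x.1.1 x.1.2
      let e : V ≃ₗ[R] R × R × W := hyperbolicSplitting B hB x.2
      refine ih (V := W) (B.restrict W) (fun u => hB u) (fun u hu => ?_) ?_ ?_
      · refine Subtype.ext (hnd _ fun y => ?_)
        obtain ⟨⟨a, b, u'⟩, rfl⟩ := e.symm.surjective y
        have hu' : B u x.1.1 = 0 ∧ B u x.1.2 = 0 := by
          rw [← hB.neg_eq x.1.1, ← hB.neg_eq x.1.2]
          simpa using mem_orthogonalPair.1 u.2
        have h₁ : e.symm (a, b, u') = a • x.1.1 + b • x.1.2 + (u' : V) := rfl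
        simpa [h₁, hu'] using hu u'
      · have h := Nat.card_congr e.toEquiv
        rw [Nat.card_prod, Nat.card_prod, hV] at h
        refine Nat.eq_of_mul_eq_mul_left (pow_pos hR 2) ?_
        linear_combination -h
      · let e' : {x : V // t • x = 0} ≃
            {a : R // t * a = 0} × {a : R // t * a = 0} × {x : W // t • x = 0} :=
          (e.toEquiv.subtypeEquiv (q := fun y => t * y.1 = 0 ∧ t * y.2.1 = 0 ∧ t • y.2.2 = 0)
            fun x => by
              rw [← e.map_eq_zero_iff, map_smul]
              simp [Prod.ext_iff]).trans
          { toFun := fun y => (⟨y.1.1, y.2.1⟩, ⟨y.1.2.1, y.2.2.1⟩, ⟨y.1.2.2, y.2.2.2⟩)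
            invFun := fun y => ⟨(y.1.1, y.2.1.1, y.2.2.1), y.1.2, y.2.1.2, y.2.2.2⟩
            left_inv := fun _ => rfl
            right_inv := fun _ => rfl }
        have h := Nat.card_congr e'
        rw [Nat.card_prod, Nat.card_prod, hVt] at h
        refine Nat.eq_of_mul_eq_mul_left (pow_pos hr 2) ?_
        linear_combination -h
    have := Fintype.ofFinite (HyperbolicPair B)
    have hpair : Nat.card (HyperbolicPair B) = Nat.card R ^ (2 * (n + 1) - 1) *
        (Nat.card R ^ (2 * (n + 1)) - Nat.card {a : R // t * a = 0} ^ (2 * (n + 1))) := by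
      refine Nat.eq_of_mul_eq_mul_right hR ?_
      rw [card_hyperbolicPair_mul_card hnd ht, hVt, hV, mul_right_comm, ← pow_succ, mul_comm]
      rfl
    have (x : HyperbolicPair B) :
        Finite (SymplecticFrame (B.restrict (orthogonalPair B x.1.1 x.1.2)) n) :=
      Subtype.finite
    rw [Nat.card_congr (symplecticFrameSuccEquiv B hB n), Nat.card_sigma,
      Finset.sum_congr rfl fun x _ => key x, Finset.sum_const, Finset.card_univ,
      ← Nat.card_eq_fintype_card, hpair, smul_eq_mul,
      Finset.prod_Icc_succ_top (Nat.le_add_left 1 n), mul_comm]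

end SymplecticFrames

section StandardForm

variable {R : Type*} [CommRing R] {n : ℕ}

lemma Omega_mul_self : Omega n R * Omega n R = -1 := by
  rw [Omega, fromBlocks_multiply, ← fromBlocks_one, fromBlocks_neg]
  simp

lemma toBilin_Omega_apply (x y : Fin n ⊕ Fin n → R) :
    Matrix.toBilin' (Omega n R) x y = x ∘ Sum.inl ⬝ᵥ y ∘ Sum.inr - x ∘ Sum.inr ⬝ᵥ y ∘ Sum.inl := by
  rw [Matrix.toBilin'_apply', Omega, fromBlocks_mulVec]
  simp [dotProduct, sub_eq_add_neg, neg_mulVec]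

lemma isAlt_toBilin_Omega : (Matrix.toBilin' (Omega n R)).IsAlt := fun x => by
  rw [toBilin_Omega_apply, dotProduct_comm, sub_self]

lemma eq_zero_of_toBilin_Omega (x : Fin n ⊕ Fin n → R)
    (h : ∀ y, Matrix.toBilin' (Omega n R) x y = 0) : x = 0 := by
  funext i
  rcases i with i | i
  · simpa [toBilin_Omega_apply, dotProduct, Pi.single_apply] using h (Pi.single (Sum.inr i) 1)
  · simpa [toBilin_Omega_apply, dotProduct, Pi.single_apply] using h (Pi.single (Sum.inl i) 1)

lemma transpose_mul_Omega_mul_apply (M : Matrix (Fin n ⊕ Fin n) (Fin n ⊕ Fin n) R)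
    (a b : Fin n ⊕ Fin n) :
    (Mᵀ * Omega n R * M) a b = Matrix.toBilin' (Omega n R) (M.col a) (M.col b) := by
  rw [Matrix.toBilin'_apply', dotProduct_mulVec]
  rfl

lemma transpose_mul_Omega_mul_eq_iff (M : Matrix (Fin n ⊕ Fin n) (Fin n ⊕ Fin n) R) :
    Mᵀ * Omega n R * M = Omega n R ↔ ∀ i j,
      Matrix.toBilin' (Omega n R) (M.col (Sum.inl i)) (M.col (Sum.inl j)) = 0 ∧
      Matrix.toBilin' (Omega n R) (M.col (Sum.inr i)) (M.col (Sum.inr j)) = 0 ∧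
      Matrix.toBilin' (Omega n R) (M.col (Sum.inl i)) (M.col (Sum.inr j)) =
        if i = j then 1 else 0 := by
  simp only [← Matrix.ext_iff, transpose_mul_Omega_mul_apply]
  constructor
  · intro h i j
    refine ⟨?_, ?_, ?_⟩ <;> rw [h] <;> simp [Omega, Matrix.one_apply]
  · rintro h (i | i) (j | j)
    · rw [(h i j).1]
      simp [Omega]
    · rw [(h i j).2.2]
      simp [Omega, Matrix.one_apply]
    · rw [← isAlt_toBilin_Omega.neg_eq, (h j i).2.2]
      simp [Omega, Matrix.one_apply, eq_comm]
    · rw [(h i j).2.1]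
      simp [Omega]

/-- The columns of a symplectic matrix form a symplectic frame. -/
def spEquivSymplecticFrame :
    Sp n R ≃ SymplecticFrame (Matrix.toBilin' (Omega n R)) n where
  toFun M := ⟨(fun i => M.1.1.col (Sum.inl i), fun i => M.1.1.col (Sum.inr i)),
    (transpose_mul_Omega_mul_eq_iff _).1 M.2⟩
  invFun f :=
    let M : Matrix (Fin n ⊕ Fin n) (Fin n ⊕ Fin n) R := (Matrix.of (Sum.elim f.1.1 f.1.2))ᵀ
    have hM : Mᵀ * Omega n R * M = Omega n R := (transpose_mul_Omega_mul_eq_iff M).2 f.2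
    have hinv : -Omega n R * Mᵀ * Omega n R * M = 1 := by
      rw [mul_assoc, mul_assoc, ← mul_assoc Mᵀ, hM, neg_mul, Omega_mul_self, neg_neg]
    ⟨⟨M, -Omega n R * Mᵀ * Omega n R, mul_eq_one_comm.1 hinv, hinv⟩, hM⟩
  left_inv M := by
    apply Subtype.ext
    apply Units.ext
    ext i (j | j) <;> rfl
  right_inv _ := rfl

theorem card_Sp [Finite R] {t : R} (ht : ∀ a : R, t * a = 0 ↔ ¬ IsUnit a) :
    Nat.card (Sp n R) = ∏ i ∈ Finset.Icc 1 n, Nat.card R ^ (2 * i - 1) *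
      (Nat.card R ^ (2 * i) - Nat.card {a : R // t * a = 0} ^ (2 * i)) := by
  rw [Nat.card_congr spEquivSymplecticFrame]
  refine card_symplecticFrame ht n _ isAlt_toBilin_Omega eq_zero_of_toBilin_Omega ?_ ?_
  · simp [Nat.card_fun, two_mul]
  · let e : {x : Fin n ⊕ Fin n → R // t • x = 0} ≃ (Fin n ⊕ Fin n → {a : R // t * a = 0}) :=
      (Equiv.subtypeEquivRight fun x => by simp [funext_iff, -Sum.forall]).trans
        (Equiv.subtypePiEquivPi (p := fun _ a => t * a = 0))
    rw [Nat.card_congr e]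
    simp [Nat.card_fun, two_mul]

end StandardForm

lemma ZMod.primePow_mul_eq_zero_iff {p : ℕ} (hp : p.Prime) (k : ℕ) (a : ZMod (p ^ (k + 1))) :
    (p : ZMod (p ^ (k + 1))) ^ k * a = 0 ↔ ¬ IsUnit a := by
  have : NeZero (p ^ (k + 1)) := ⟨(pow_pos hp.pos _).ne'⟩
  obtain ⟨m, rfl⟩ := ZMod.natCast_zmod_surjective a
  rw [ZMod.isUnit_iff_coprime, Nat.coprime_pow_right_iff k.succ_pos, Nat.coprime_comm,
    hp.coprime_iff_not_dvd, not_not, ← Nat.cast_pow, ← Nat.cast_mul, ZMod.natCast_eq_zero_iff,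
    pow_succ, Nat.mul_dvd_mul_iff_left (pow_pos hp.pos k)]

lemma ZMod.card_primePow_mul_eq_zero {p : ℕ} (hp : p.Prime) (k : ℕ) :
    Nat.card {a : ZMod (p ^ (k + 1)) // (p : ZMod (p ^ (k + 1))) ^ k * a = 0} = p ^ k := by
  classical
  have : NeZero (p ^ (k + 1)) := ⟨(pow_pos hp.pos _).ne'⟩
  have hu : Fintype.card {a : ZMod (p ^ (k + 1)) // IsUnit a} = p ^ k * (p - 1) := by
    rw [← Nat.totient_prime_pow_succ hp, ← ZMod.card_units_eq_totient]
    exact Fintype.card_congr Submonoid.unitsTypeEquivIsUnitSubmonoid.symm.toEquiv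
  rw [Nat.card_congr (Equiv.subtypeEquivRight (ZMod.primePow_mul_eq_zero_iff hp k)),
    Nat.card_eq_fintype_card, Fintype.card_subtype_compl, hu, ZMod.card, pow_succ,
    ← Nat.mul_sub, Nat.sub_sub_self hp.one_le, mul_one]

/-- **Order of the symplectic group over `ℤ/p^kℤ`.**
`|Sp(2n, ℤ/p^kℤ)| = p^((2k-1)n² + (k-1)n) · ∏_{i=1}^n (p^(2i) - 1)`
(equivalently, `p^(k(2n²+n)) · ∏_{i=1}^n (1 - p^{-2i})`). -/
theorem card_Sp_zmod_primePow (p : ℕ) (hp : p.Prime) (n k : ℕ) (hn : 1 ≤ n) (hk : 1 ≤ k) :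
    Nat.card (Sp n (ZMod (p ^ k))) =
      p ^ ((2 * k - 1) * n ^ 2 + (k - 1) * n) * ∏ i ∈ Finset.Icc 1 n, (p ^ (2 * i) - 1) := by
  obtain ⟨k, rfl⟩ := Nat.exists_eq_add_of_le' hk
  have : NeZero (p ^ (k + 1)) := ⟨(pow_pos hp.pos _).ne'⟩
  rw [card_Sp (ZMod.primePow_mul_eq_zero_iff hp k), ZMod.card_primePow_mul_eq_zero hp,
    Nat.card_zmod]
  clear hn
  induction n with
  | zero => simp
  | succ n ih =>
    rw [Finset.prod_Icc_succ_top (Nat.le_add_left 1 n), ih,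
      Finset.prod_Icc_succ_top (Nat.le_add_left 1 n)]
    have h : (p ^ (k + 1)) ^ (2 * (n + 1)) - (p ^ k) ^ (2 * (n + 1)) =
        (p ^ k) ^ (2 * (n + 1)) * (p ^ (2 * (n + 1)) - 1) := by
      rw [pow_succ p k, mul_pow, Nat.mul_sub, mul_one]
    rw [h, show 2 * (n + 1) - 1 = 2 * n + 1 by omega, show 2 * (k + 1) - 1 = 2 * k + 1 by omega,
      Nat.add_sub_cancel]
    ring
end

section
/- Let p be a prime and n ≥ 1, k ≥ 1 integers. The kernel of the reduction homomorphism Sp(2n, ZMod p^(k+1)) → Sp(2n, ZMod p^k) (induced by the canonical ring map applied entrywise) has cardinality exactly p^(2n² + n). -/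
open Matrix

variable {R S : Type*} [CommRing R] [CommRing S]

lemma Omega_map (n : ℕ) (f : R →+* S) : (Omega n R).map f = Omega n S := by
  have h1 : ((-1 : Matrix (Fin n) (Fin n) R)).map f = -1 := by
    ext i j
    simp [Matrix.one_apply, apply_ite f]
  simp [Omega, Matrix.fromBlocks_map, Matrix.map_zero _ (map_zero f),
    Matrix.map_one _ (map_zero f) (map_one f), h1]

lemma map_mem_Sp (n : ℕ) (f : R →+* S) {M : GL (Fin n ⊕ Fin n) R} (hM : M ∈ Sp n R) :
    Matrix.GeneralLinearGroup.map f M ∈ Sp n S := by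
  have hcoe : (Matrix.GeneralLinearGroup.map f M).val = M.val.map f := rfl
  show (Matrix.GeneralLinearGroup.map f M).val ᵀ * Omega n S * (Matrix.GeneralLinearGroup.map f M).val = Omega n S
  rw [hcoe, ← Matrix.transpose_map, ← Omega_map n f, ← Matrix.map_mul, ← Matrix.map_mul]
  rw [show M.valᵀ * Omega n R * M.val = Omega n R from hM]

/-- The reduction homomorphism between symplectic groups induced by a ring map. -/
def spHom (n : ℕ) (f : R →+* S) : Sp n R →* Sp n S :=
  ((Matrix.GeneralLinearGroup.map f).comp (Sp n R).subtype).codRestrict (Sp n S)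
    (fun M => map_mem_Sp n f M.property)

section SquareZero

variable {ι : Type*} [Fintype ι] {f : R →+* S}

lemma Matrix.mul_eq_zero_of_mem_ker
    (hf : ∀ x ∈ RingHom.ker f, ∀ y ∈ RingHom.ker f, x * y = 0)
    {X Y : Matrix ι ι R} (hX : ∀ i j, X i j ∈ RingHom.ker f)
    (hY : ∀ i j, Y i j ∈ RingHom.ker f) : X * Y = 0 := by
  ext i j
  exact Finset.sum_eq_zero fun l _ => hf _ (hX i l) _ (hY l j)

/-- For a ring homomorphism with square-zero kernel, a matrix with entries in the kernel gives
an invertible matrix `1 + X`. -/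
@[simps]
def oneAddUnit [DecidableEq ι]
    (hf : ∀ x ∈ RingHom.ker f, ∀ y ∈ RingHom.ker f, x * y = 0)
    (X : Matrix ι ι R) (hX : ∀ i j, X i j ∈ RingHom.ker f) : GL ι R where
  val := 1 + X
  inv := 1 - X
  val_inv := by
    rw [Matrix.add_mul, Matrix.one_mul, Matrix.mul_sub, Matrix.mul_one,
      Matrix.mul_eq_zero_of_mem_ker hf hX hX]
    abel
  inv_val := by
    rw [Matrix.sub_mul, Matrix.one_mul, Matrix.mul_add, Matrix.mul_one,
      Matrix.mul_eq_zero_of_mem_ker hf hX hX]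
    abel

end SquareZero

lemma one_add_preserves_Omega_iff {n : ℕ} {f : R →+* S}
    (hf : ∀ x ∈ RingHom.ker f, ∀ y ∈ RingHom.ker f, x * y = 0)
    {X : Matrix (Fin n ⊕ Fin n) (Fin n ⊕ Fin n) R} (hX : ∀ i j, X i j ∈ RingHom.ker f) :
    (1 + X)ᵀ * Omega n R * (1 + X) = Omega n R ↔ Xᵀ * Omega n R + Omega n R * X = 0 := by
  have h : Xᵀ * (Omega n R * X) = 0 :=
    Matrix.mul_eq_zero_of_mem_ker hf (fun i j => hX j i) fun i j => by
      rw [Matrix.mul_apply]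
      exact Ideal.sum_mem _ fun l _ => Ideal.mul_mem_left _ _ (hX l j)
  have e : (1 + X)ᵀ * Omega n R * (1 + X) =
      Omega n R + (Xᵀ * Omega n R + Omega n R * X) := by
    rw [transpose_add, transpose_one, Matrix.add_mul, Matrix.one_mul, Matrix.mul_add,
      Matrix.mul_one, Matrix.add_mul, Matrix.mul_assoc, h]
    abel
  rw [e, add_eq_left]

lemma mem_ker_spHom_iff {n : ℕ} {f : R →+* S} {M : Sp n R} :
    M ∈ (spHom n f).ker ↔ ∀ i j, (M.1.1 - 1) i j ∈ RingHom.ker f := by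
  have hone : (1 : Matrix (Fin n ⊕ Fin n) (Fin n ⊕ Fin n) R).map f = 1 :=
    Matrix.map_one _ (map_zero f) (map_one f)
  have : M ∈ (spHom n f).ker ↔ M.1.1.map f = 1 := by
    rw [MonoidHom.mem_ker, Subtype.ext_iff, Units.ext_iff]
    rfl
  rw [this, ← hone, ← Matrix.ext_iff]
  simp [RingHom.mem_ker, sub_eq_zero]

/-- The kernel of `Sp(2n, R) → Sp(2n, S)` for a ring homomorphism with square-zero kernel `I`
is in bijection with the symplectic Lie algebra with entries in `I`. -/
def kerSpHomEquiv (n : ℕ) (f : R →+* S)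
    (hf : ∀ x ∈ RingHom.ker f, ∀ y ∈ RingHom.ker f, x * y = 0) :
    (spHom n f).ker ≃ {X : Matrix (Fin n ⊕ Fin n) (Fin n ⊕ Fin n) R //
      (∀ i j, X i j ∈ RingHom.ker f) ∧ Xᵀ * Omega n R + Omega n R * X = 0} where
  toFun M := ⟨M.1.1.1 - 1, mem_ker_spHom_iff.1 M.2,
    (one_add_preserves_Omega_iff hf (mem_ker_spHom_iff.1 M.2)).1 <| by
      rw [add_sub_cancel]
      exact M.1.2⟩
  invFun X := ⟨⟨oneAddUnit hf X.1 X.2.1, (one_add_preserves_Omega_iff hf X.2.1).2 X.2.2⟩,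
    mem_ker_spHom_iff.2 <| by simpa using X.2.1⟩
  left_inv M := Subtype.ext <| Subtype.ext <| Units.ext <| by simp
  right_inv X := Subtype.ext <| by simp

lemma fromBlocks_transpose_mul_Omega_add_eq_zero_iff {n : ℕ}
    {A B C D : Matrix (Fin n) (Fin n) R} :
    (fromBlocks A B C D)ᵀ * Omega n R + Omega n R * fromBlocks A B C D = 0 ↔
      D = -Aᵀ ∧ B.IsSymm ∧ C.IsSymm := by
  rw [Omega, fromBlocks_transpose, fromBlocks_multiply, fromBlocks_multiply, fromBlocks_add,
    ← fromBlocks_zero, fromBlocks_inj]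
  simp only [Matrix.mul_zero, Matrix.zero_mul, Matrix.mul_one, Matrix.one_mul, Matrix.mul_neg,
    Matrix.neg_mul, zero_add, add_zero, Matrix.IsSymm]
  constructor
  · rintro ⟨h₁, h₂, -, h₄⟩
    exact ⟨by rwa [add_comm, add_eq_zero_iff_eq_neg] at h₂,
      by rwa [← sub_eq_add_neg, sub_eq_zero] at h₄, by rwa [neg_add_eq_zero] at h₁⟩
  · rintro ⟨rfl, hB, hC⟩
    simp [hB, hC]

/-- The symplectic Lie algebra with entries in an ideal `I`, in coordinates: an arbitrary block
and two symmetric blocks. -/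
def symplecticLieEquiv (n : ℕ) (I : Ideal R) :
    {X : Matrix (Fin n ⊕ Fin n) (Fin n ⊕ Fin n) R //
      (∀ i j, X i j ∈ I) ∧ Xᵀ * Omega n R + Omega n R * X = 0} ≃
      (Fin n × Fin n → I) × (Sym2 (Fin n) → I) × (Sym2 (Fin n) → I) where
  toFun X :=
    have h := fromBlocks_transpose_mul_Omega_add_eq_zero_iff.1
      ((fromBlocks_toBlocks X.1).symm ▸ X.2.2)
    (fun ij => ⟨X.1 (.inl ij.1) (.inl ij.2), X.2.1 _ _⟩,
      Sym2.lift ⟨fun i j => ⟨X.1 (.inl i) (.inr j), X.2.1 _ _⟩,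
        fun i j => Subtype.ext (h.2.1.apply j i)⟩,
      Sym2.lift ⟨fun i j => ⟨X.1 (.inr i) (.inl j), X.2.1 _ _⟩,
        fun i j => Subtype.ext (h.2.2.apply j i)⟩)
  invFun Y :=
    ⟨fromBlocks (.of fun i j => (Y.1 (i, j) : R)) (.of fun i j => (Y.2.1 s(i, j) : R))
      (.of fun i j => (Y.2.2 s(i, j) : R)) (-(Matrix.of fun i j => (Y.1 (i, j) : R))ᵀ), by
      rintro (i | i) (j | j) <;> simp, by
      refine fromBlocks_transpose_mul_Omega_add_eq_zero_iff.2 ⟨rfl, ?_, ?_⟩ <;>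
      · ext i j
        simp [Sym2.eq_swap]⟩
  left_inv X := by
    have h := fromBlocks_transpose_mul_Omega_add_eq_zero_iff.1
      ((fromBlocks_toBlocks X.1).symm ▸ X.2.2)
    ext (i | i) (j | j)
    · simp
    · simp
    · simp
    · simpa [toBlocks₁₁, toBlocks₂₂] using (congr_fun₂ h.1 i j).symm
  right_inv Y := by
    refine Prod.ext rfl (Prod.ext ?_ ?_) <;>
    · ext z
      induction z with
      | _ i j => simp

lemma card_ker_spHom_of_mul_eq_zero (n : ℕ) (f : R →+* S)
    (hf : ∀ x ∈ RingHom.ker f, ∀ y ∈ RingHom.ker f, x * y = 0) :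
    Nat.card (spHom n f).ker = Nat.card (RingHom.ker f) ^ (2 * n ^ 2 + n) := by
  rw [Nat.card_congr ((kerSpHomEquiv n f hf).trans (symplecticLieEquiv n (RingHom.ker f)))]
  have h : n * n + ((n + 1).choose 2 + (n + 1).choose 2) = 2 * n ^ 2 + n := by
    have hdiv := Nat.div_mul_cancel (Nat.even_mul_pred_self (n + 1)).two_dvd
    rw [Nat.choose_two_right]
    simp only [Nat.add_sub_cancel] at hdiv ⊢
    nlinarith
  simp [Nat.card_prod, Nat.card_fun, Sym2.card, ← pow_add, h]

lemma ZMod.mul_eq_zero_of_mem_ker_castHom_pow {p k : ℕ} (hp : p ≠ 0) (hk : 1 ≤ k)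
    (x : ZMod (p ^ (k + 1)))
    (hx : x ∈ RingHom.ker (ZMod.castHom (pow_dvd_pow p k.le_succ) (ZMod (p ^ k))))
    (y : ZMod (p ^ (k + 1)))
    (hy : y ∈ RingHom.ker (ZMod.castHom (pow_dvd_pow p k.le_succ) (ZMod (p ^ k)))) :
    x * y = 0 := by
  have : NeZero p := ⟨hp⟩
  obtain ⟨a, rfl⟩ := ZMod.natCast_zmod_surjective x
  obtain ⟨b, rfl⟩ := ZMod.natCast_zmod_surjective y
  rw [RingHom.mem_ker, map_natCast, ZMod.natCast_eq_zero_iff] at hx hy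
  rw [← Nat.cast_mul, ZMod.natCast_eq_zero_iff]
  calc p ^ (k + 1) ∣ p ^ (k + k) := pow_dvd_pow p (by lia)
    _ = p ^ k * p ^ k := pow_add p k k
    _ ∣ a * b := mul_dvd_mul hx hy

lemma ZMod.card_ker_castHom_pow {p : ℕ} (k : ℕ) (hp : p ≠ 0) :
    Nat.card (RingHom.ker (ZMod.castHom (pow_dvd_pow p k.le_succ) (ZMod (p ^ k)))) = p := by
  have h := Submodule.card_eq_card_quotient_mul_card
    (RingHom.ker (ZMod.castHom (pow_dvd_pow p k.le_succ) (ZMod (p ^ k))))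
  rw [Nat.card_congr (RingHom.quotientKerEquivOfSurjective
    (ZMod.castHom_surjective (pow_dvd_pow p k.le_succ))).toEquiv, Nat.card_zmod,
    Nat.card_zmod] at h
  exact (Nat.eq_of_mul_eq_mul_right (by positivity) ((pow_succ' p k).symm.trans h)).symm

/-- **Kernel of reduction.** The kernel of the reduction homomorphism
`Sp(2n, ℤ/p^(k+1)ℤ) → Sp(2n, ℤ/p^kℤ)` (applying the canonical ring map entrywise)
has cardinality `p^(2n² + n)`. -/
theorem card_ker_spHom_reduction (p : ℕ) (hp : p.Prime) (n k : ℕ) (hn : 1 ≤ n) (hk : 1 ≤ k) :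
    Nat.card
      (spHom n (ZMod.castHom (pow_dvd_pow p k.le_succ) (ZMod (p ^ k)))).ker =
      p ^ (2 * n ^ 2 + n) := by
  rw [card_ker_spHom_of_mul_eq_zero n _
    (ZMod.mul_eq_zero_of_mem_ker_castHom_pow hp.ne_zero hk), ZMod.card_ker_castHom_pow k hp.ne_zero]
end

section
/- Let p be a prime and n ≥ 1 an integer. The cardinality of the symplectic group Sp(2n, ZMod p) over the field with p elements equals p^(n²) · ∏_{i=1}^{n} (p^{2i} - 1). -/
open Matrix

namespace SymplecticFrame

variable {F V : Type*} [Field F] [AddCommGroup V] [Module F V]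

/-- Families of vectors whose Gram matrix with respect to `B` is `Omega n F`. -/
def Frame (B : V →ₗ[F] V →ₗ[F] F) (n : ℕ) : Type _ :=
  {v : Fin n ⊕ Fin n → V // ∀ i j, B (v i) (v j) = Omega n F i j}

/-- The vectors `B`-orthogonal to both `e` and `f`. -/
def orthPair (B : V →ₗ[F] V →ₗ[F] F) (e f : V) : Submodule F V :=
  LinearMap.ker (B e) ⊓ LinearMap.ker (B f)

theorem mem_orthPair {B : V →ₗ[F] V →ₗ[F] F} {e f w : V} :
    w ∈ orthPair B e f ↔ B e w = 0 ∧ B f w = 0 := by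
  simp [orthPair]

theorem sub_add_mem_orthPair {B : V →ₗ[F] V →ₗ[F] F} (hB : B.IsAlt) {e f : V}
    (h : B e f = 1) (v : V) : v - B e v • f + B f v • e ∈ orthPair B e f := by
  have hfe : B f e = -1 := by rw [← hB.neg, h]
  simp [mem_orthPair, h, hfe, hB.self_eq_zero]

/-- A hyperbolic pair splits off its span as a direct summand. -/
def splitEquiv {B : V →ₗ[F] V →ₗ[F] F} (hB : B.IsAlt) {e f : V} (h : B e f = 1) :
    V ≃ orthPair B e f × F × F where
  toFun v := (⟨_, sub_add_mem_orthPair hB h v⟩, B e v, B f v)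
  invFun x := x.1 + x.2.1 • f - x.2.2 • e
  left_inv v := by simp only; abel
  right_inv := by
    rintro ⟨⟨w, hw⟩, a, b⟩
    have hfe : B f e = -1 := by rw [← hB.neg, h]
    obtain ⟨h1, h2⟩ := mem_orthPair.1 hw
    have ha : B e (w + a • f - b • e) = a := by simp [h1, h, hB.self_eq_zero]
    have hb : B f (w + a • f - b • e) = b := by simp [h2, hfe, hB.self_eq_zero]
    ext
    · simp only [ha, hb]; abel
    · exact ha
    · exact hb

theorem eq_zero_of_orthPair {B : V →ₗ[F] V →ₗ[F] F} (hB : B.IsAlt) (hnd : B.SeparatingLeft)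
    {e f : V} (h : B e f = 1) {w : V} (hw : w ∈ orthPair B e f)
    (hperp : ∀ u ∈ orthPair B e f, B w u = 0) : w = 0 := by
  refine hnd w fun v => ?_
  obtain ⟨h1, h2⟩ := mem_orthPair.1 hw
  have := hperp _ (sub_add_mem_orthPair hB h v)
  have h1' : B w e = 0 := by rw [← hB.neg, h1, neg_zero]
  have h2' : B w f = 0 := by rw [← hB.neg, h2, neg_zero]
  simpa [h1', h2'] using this

/-- `V` is a product of `F` with any fibre of a nonzero linear functional. -/
def fibreEquiv (φ : V →ₗ[F] F) {g : V} (hg : φ g = 1) : V ≃ {f : V // φ f = 1} × F where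
  toFun v := (⟨v + (1 - φ v) • g, by simp [hg]⟩, φ v)
  invFun x := x.1 + (x.2 - 1) • g
  left_inv v := by simp only [add_assoc, ← add_smul]; simp
  right_inv := by
    rintro ⟨⟨f, hf⟩, c⟩
    have hc : φ (f + (c - 1) • g) = c := by simp [hf, hg]
    ext
    · simp only [hc, add_assoc, ← add_smul]; simp
    · exact hc

theorem card_fibre_mul {B : V →ₗ[F] V →ₗ[F] F} (hnd : B.SeparatingLeft) {e : V} (he : e ≠ 0) :
    Nat.card {f : V // B e f = 1} * Nat.card F = Nat.card V := by
  obtain ⟨g, hg⟩ : ∃ g, B e g ≠ 0 := by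
    by_contra! hall
    exact he (hnd e hall)
  rw [Nat.card_congr (fibreEquiv (B e) (g := (B e g)⁻¹ • g) (by simp [hg])), Nat.card_prod]

/-- The restriction of a bilinear form to a submodule. -/
abbrev restrict (B : V →ₗ[F] V →ₗ[F] F) (W : Submodule F V) : W →ₗ[F] W →ₗ[F] F :=
  B.domRestrict₁₂ W W

@[simp]
theorem Omega_inl_inl {n : ℕ} (i j : Fin n) : Omega n F (.inl i) (.inl j) = 0 := by
  simp [Omega]

@[simp]
theorem Omega_inr_inr {n : ℕ} (i j : Fin n) : Omega n F (.inr i) (.inr j) = 0 := by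
  simp [Omega]

@[simp]
theorem Omega_inl_inr {n : ℕ} (i j : Fin n) :
    Omega n F (.inl i) (.inr j) = if i = j then 1 else 0 := by
  simp [Omega, Matrix.one_apply]

@[simp]
theorem Omega_inr_inl {n : ℕ} (i j : Fin n) :
    Omega n F (.inr i) (.inl j) = if i = j then -1 else 0 := by
  simp only [Omega, Matrix.fromBlocks_apply₂₁, Matrix.neg_apply, Matrix.one_apply]
  split_ifs <;> simp

/-- A frame consists of its first hyperbolic pair and a frame of the orthogonal complement. -/
def frameSuccEquiv {B : V →ₗ[F] V →ₗ[F] F} (hB : B.IsAlt) (n : ℕ) :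
    Frame B (n + 1) ≃
      Σ e : {e : V // e ≠ 0}, Σ f : {f : V // B e f = 1},
        Frame (restrict B (orthPair B e.1 f.1)) n where
  toFun v :=
    ⟨⟨v.1 (.inl 0), fun h0 => by simpa [h0] using v.2 (.inl 0) (.inr 0)⟩,
      ⟨v.1 (.inr 0), by simp [v.2]⟩,
      ⟨fun i => ⟨v.1 (i.map Fin.succ Fin.succ), by
        rw [mem_orthPair, v.2, v.2]
        rcases i with i | i <;> simp [(Fin.succ_ne_zero i).symm]⟩, by
        rintro (i | i) (j | j) <;>
          exact (v.2 _ _).trans (by simp)⟩⟩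
  invFun x :=
    ⟨Sum.elim (Fin.cons x.1.1 fun i => (x.2.2.1 (.inl i)).1)
      (Fin.cons x.2.1.1 fun i => (x.2.2.1 (.inr i)).1), by
      obtain ⟨⟨e, he⟩, ⟨f, hf⟩, ⟨w, hw⟩⟩ := x
      have hfe : B f e = -1 := by rw [← hB.neg, hf]
      have h1 i : B e (w i) = 0 := (mem_orthPair.1 (w i).2).1
      have h2 i : B f (w i) = 0 := (mem_orthPair.1 (w i).2).2
      have h1' i : B (w i) e = 0 := by rw [← hB.neg, h1, neg_zero]
      have h2' i : B (w i) f = 0 := by rw [← hB.neg, h2, neg_zero]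
      have hw' i j : B (w i) (w j) = Omega n F i j := hw i j
      rintro (i | i) (j | j) <;> cases i using Fin.cases <;> cases j using Fin.cases <;>
        simp_all [hB.self_eq_zero, Fin.succ_ne_zero, (Fin.succ_ne_zero _).symm]⟩
  left_inv v := by
    apply Subtype.ext
    funext i
    rcases i with i | i <;> cases i using Fin.cases <;> rfl
  right_inv := by
    rintro ⟨⟨e, he⟩, ⟨f, hf⟩, ⟨w, hw⟩⟩
    refine Sigma.ext rfl (heq_of_eq (Sigma.ext rfl (heq_of_eq (Subtype.ext (funext fun i => ?_)))))
    rcases i with i | i <;> rfl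

theorem card_frame {F : Type*} [Field F] [Finite F] (n : ℕ) :
    ∀ {V : Type*} [AddCommGroup V] [Module F V] (B : V →ₗ[F] V →ₗ[F] F),
      B.IsAlt → B.SeparatingLeft → Nat.card V = Nat.card F ^ (2 * n) →
      Nat.card (Frame B n) =
        Nat.card F ^ (n ^ 2) * ∏ i ∈ Finset.Icc 1 n, (Nat.card F ^ (2 * i) - 1) := by
  have hq : 0 < Nat.card F := Nat.card_pos
  induction n with
  | zero =>
    intro V _ _ B _ _ _
    have : Unique (Frame B 0) :=
      { default := ⟨isEmptyElim, fun i => isEmptyElim i⟩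
        uniq := fun v => Subtype.ext (Subsingleton.elim _ _) }
    simp
  | succ n ih =>
    intro V _ _ B hB hnd hV
    have hfin : Finite V := Nat.finite_of_card_ne_zero (by rw [hV]; positivity)
    have hfinFrame {W : Submodule F V} : Finite (Frame (restrict B W) n) := Subtype.finite
    have := Fintype.ofFinite V
    classical
    have hcompl (e f : V) (h : B e f = 1) : Nat.card (Frame (restrict B (orthPair B e f)) n) =
        Nat.card F ^ (n ^ 2) * ∏ i ∈ Finset.Icc 1 n, (Nat.card F ^ (2 * i) - 1) := by
      refine ih _ (fun w => hB w.1) (fun w hw => ?_) ?_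
      · exact Subtype.ext (eq_zero_of_orthPair hB hnd h w.2 fun u hu => hw ⟨u, hu⟩)
      · have := Nat.card_congr (splitEquiv hB h)
        rw [hV, Nat.card_prod, Nat.card_prod] at this
        refine Nat.eq_of_mul_eq_mul_right (Nat.mul_pos hq hq) ?_
        rw [← this]
        ring
    have hfibre (e : {e : V // e ≠ 0}) :
        Nat.card {f : V // B e f = 1} = Nat.card F ^ (2 * n + 1) := by
      refine Nat.eq_of_mul_eq_mul_right hq ?_
      rw [card_fibre_mul hnd e.2, hV]
      ring
    have hne : Nat.card {e : V // e ≠ 0} = Nat.card F ^ (2 * (n + 1)) - 1 := by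
      rw [← hV, Nat.card_eq_fintype_card, Nat.card_eq_fintype_card, Fintype.card_subtype_compl,
        Fintype.card_subtype_eq]
    rw [Nat.card_congr (frameSuccEquiv hB n), Nat.card_sigma]
    simp_rw [Nat.card_sigma]
    rw [Finset.sum_congr rfl fun e _ => Finset.sum_congr rfl fun f _ => hcompl e.1 f.1 f.2]
    simp only [Finset.sum_const, Finset.card_univ, ← Nat.card_eq_fintype_card, hfibre, hne,
      smul_eq_mul]
    rw [Finset.prod_Icc_succ_top (by omega)]
    ring

theorem Omega_mul_self (n : ℕ) (R : Type*) [CommRing R] : Omega n R * Omega n R = -1 := by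
  simp [Omega, Matrix.fromBlocks_multiply, ← Matrix.fromBlocks_one, Matrix.fromBlocks_neg]

theorem isUnit_det_Omega (n : ℕ) (R : Type*) [CommRing R] : IsUnit (Omega n R).det := by
  refine (Matrix.isUnit_iff_isUnit_det _).1 ⟨⟨Omega n R, -Omega n R, ?_, ?_⟩, rfl⟩ <;>
    simp [Omega_mul_self]

/-- The alternating form on the column space with Gram matrix `Omega n F`. -/
noncomputable abbrev stdForm (n : ℕ) (F : Type*) [Field F] :
    (Fin n ⊕ Fin n → F) →ₗ[F] (Fin n ⊕ Fin n → F) →ₗ[F] F :=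
  Matrix.toLinearMap₂' F (Omega n F)

theorem isAlt_stdForm (n : ℕ) (F : Type*) [Field F] : (stdForm n F).IsAlt := by
  intro x
  obtain ⟨a, b, rfl⟩ : ∃ a b, x = Sum.elim a b := ⟨_, _, (Sum.elim_comp_inl_inr x).symm⟩
  simp [Matrix.toLinearMap₂'_apply', Omega, Matrix.fromBlocks_mulVec, Matrix.neg_mulVec,
    dotProduct_comm b a]

theorem separatingLeft_stdForm (n : ℕ) (F : Type*) [Field F] : (stdForm n F).SeparatingLeft :=
  LinearMap.separatingLeft_toLinearMap₂'_of_det_ne_zero' (isUnit_det_Omega n F).ne_zero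

theorem stdForm_col (n : ℕ) (M : Matrix (Fin n ⊕ Fin n) (Fin n ⊕ Fin n) F) (i j) :
    stdForm n F (M.col i) (M.col j) = (Mᵀ * Omega n F * M) i j := by
  rw [Matrix.toLinearMap₂'_apply', Matrix.mul_assoc]
  rfl

/-- A symplectic matrix is determined by the frame formed by its columns. -/
noncomputable def spEquivFrame (n : ℕ) (F : Type*) [Field F] :
    Sp n F ≃ Frame (stdForm n F) n where
  toFun M := ⟨M.1.1.col, fun i j => by
    rw [stdForm_col]
    exact congrFun₂ M.2 i j⟩
  invFun v :=
    have h : (Matrix.of v.1)ᵀᵀ * Omega n F * (Matrix.of v.1)ᵀ = Omega n F := by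
      ext i j
      rw [← stdForm_col]
      exact v.2 i j
    ⟨Matrix.GeneralLinearGroup.mkOfDetNeZero (Matrix.of v.1)ᵀ fun h0 => by
      have := congrArg Matrix.det h
      rw [Matrix.det_mul, h0, mul_zero] at this
      exact (isUnit_det_Omega n F).ne_zero this.symm, h⟩
  left_inv M := by
    apply Subtype.ext
    apply Units.ext
    rfl
  right_inv v := rfl

end SymplecticFrame

/-- **Order of the symplectic group over the field `ℤ/pℤ`.**
`|Sp(2n, ℤ/pℤ)| = p^(n²) · ∏_{i=1}^n (p^(2i) - 1)`. -/
theorem card_Sp_zmod_prime (p : ℕ) (hp : p.Prime) (n : ℕ) (hn : 1 ≤ n) :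
    Nat.card (Sp n (ZMod p)) = p ^ (n ^ 2) * ∏ i ∈ Finset.Icc 1 n, (p ^ (2 * i) - 1) := by
  have : Fact p.Prime := ⟨hp⟩
  rw [Nat.card_congr (SymplecticFrame.spEquivFrame n (ZMod p)),
    SymplecticFrame.card_frame n _ (SymplecticFrame.isAlt_stdForm n _)
      (SymplecticFrame.separatingLeft_stdForm n _) (by simp [two_mul]), Nat.card_zmod]
end

section
/- Let l be a prime, e ≥ 1 and m ≥ 1 integers, and let W be any ZMod l^e-submodule of (ZMod l^e)^m. Then there exist an invertible matrix g ∈ GL_m(ZMod l^e) and natural numbers c_1 ≤ c_2 ≤ ... ≤ c_m with each c_k ≤ e, such that the image of W under the linear automorphism given by g equals the submodule { v ∈ (ZMod l^e)^m : for each k, the k-th coordinate v_k lies in the ideal generated by l^{c_k} }; in particular, W is isomorphic as a ZMod l^e-module to the product ∏_{k=1}^{m} (l^{c_k} · ZMod l^e). -/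
open Matrix

/-- **Smith normal form of a submodule of `R^ι` over a principal ideal domain**, in matrix form:
an invertible matrix carries the submodule to a product of principal ideals. -/
theorem exists_GL_map_eq_pi_span_of_isPrincipalIdealRing {R ι : Type*} [CommRing R] [IsDomain R]
    [IsPrincipalIdealRing R] [Fintype ι] [DecidableEq ι] (N : Submodule R (ι → R)) :
    ∃ (g : GL ι R) (a : ι → R), N.map (Matrix.mulVecLin g.val) =
      Submodule.pi Set.univ (fun k => Ideal.span {a k}) := by
  obtain ⟨n, snf⟩ := N.smithNormalForm (Pi.basisFun R ι)
  let L : (ι → R) ≃ₗ[R] (ι → R) := snf.bM.equivFun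
  refine ⟨Matrix.GeneralLinearGroup.toLin.symm (LinearMap.GeneralLinearGroup.ofLinearEquiv L),
    Function.extend snf.f snf.a 0, ?_⟩
  have hL : Matrix.mulVecLin (Matrix.GeneralLinearGroup.toLin.symm
      (LinearMap.GeneralLinearGroup.ofLinearEquiv L)).val = (L : (ι → R) →ₗ[R] (ι → R)) :=
    Matrix.toLin'_toMatrix' _
  rw [hL]
  apply le_antisymm
  · rintro _ ⟨x, hx, rfl⟩ k -
    change snf.bM.repr x k ∈ Ideal.span {Function.extend snf.f snf.a 0 k}
    by_cases hk : k ∈ Set.range snf.f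
    · obtain ⟨i, rfl⟩ := hk
      rw [snf.f.injective.extend_apply, Ideal.mem_span_singleton]
      have h := snf.repr_apply_embedding_eq_repr_smul (m := ⟨x, hx⟩) (i := i)
      rw [h, map_smul]
      exact ⟨_, rfl⟩
    · have h := snf.repr_eq_zero_of_notMem_range ⟨x, hx⟩ hk
      rw [h]
      exact zero_mem _
  · intro v hv
    refine ⟨L.symm v, ?_, L.apply_symm_apply v⟩
    change snf.bM.equivFun.symm v ∈ N
    rw [snf.bM.equivFun_symm_apply]
    refine N.sum_mem fun k _ => ?_
    obtain ⟨r, hr⟩ := Ideal.mem_span_singleton.1 (hv k trivial)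
    by_cases hk : k ∈ Set.range snf.f
    · obtain ⟨i, rfl⟩ := hk
      rw [hr, snf.f.injective.extend_apply, mul_comm, mul_smul, ← snf.snf]
      exact N.smul_mem _ (snf.bN i).2
    · rw [hr, Function.extend_apply' _ _ _ hk]
      simp

/-- A submodule of `S^ι`, where `S` is a quotient of a principal ideal domain, is carried to a
product of principal ideals by an invertible matrix. -/
theorem exists_GL_map_eq_pi_span_of_surjective {R S ι : Type*} [CommRing R] [IsDomain R]
    [IsPrincipalIdealRing R] [CommRing S] [Fintype ι] [DecidableEq ι] (φ : R →+* S)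
    (hφ : Function.Surjective φ) (W : Submodule S (ι → S)) :
    ∃ (g : GL ι S) (a : ι → S), W.map (Matrix.mulVecLin g.val) =
      Submodule.pi Set.univ (fun k => Ideal.span {a k}) := by
  let N : Submodule R (ι → R) :=
    { carrier := {v | φ ∘ v ∈ W}
      add_mem' := fun {v w} hv hw => by
        have h : φ ∘ (v + w) = φ ∘ v + φ ∘ w := by ext; simp
        rw [Set.mem_ofPred_eq, h]
        exact W.add_mem hv hw
      zero_mem' := by
        have h : φ ∘ (0 : ι → R) = 0 := by ext; simp
        rw [Set.mem_ofPred_eq, h]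
        exact W.zero_mem
      smul_mem' := fun r v hv => by
        have h : φ ∘ (r • v) = φ r • (φ ∘ v) := by ext; simp
        rw [Set.mem_ofPred_eq, h]
        exact W.smul_mem _ hv }
  obtain ⟨g, a, h⟩ := exists_GL_map_eq_pi_span_of_isPrincipalIdealRing N
  have key (v : ι → R) : φ ∘ (g.val *ᵥ v) = (g.map φ).val *ᵥ (φ ∘ v) := by
    ext i
    exact RingHom.map_mulVec φ g.val v i
  refine ⟨g.map φ, φ ∘ a, le_antisymm ?_ ?_⟩
  · rintro _ ⟨w, hw, rfl⟩ k -
    obtain ⟨v, rfl⟩ := hφ.comp_left w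
    have hv : g.val *ᵥ v ∈ N.map (Matrix.mulVecLin g.val) := ⟨v, hw, rfl⟩
    rw [h] at hv
    rw [Matrix.mulVecLin_apply, ← key]
    exact Ideal.mem_span_singleton.2 (map_dvd φ (Ideal.mem_span_singleton.1 (hv k trivial)))
  · intro w hw
    choose r hr using fun k => Ideal.mem_span_singleton.1 (hw k trivial)
    obtain ⟨s, rfl⟩ := hφ.comp_left r
    have hv : a * s ∈ N.map (Matrix.mulVecLin g.val) := by
      rw [h]
      exact fun k _ => Ideal.mem_span_singleton.2 ⟨s k, rfl⟩
    obtain ⟨v, hv, hvs⟩ := hv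
    refine ⟨φ ∘ v, hv, ?_⟩
    rw [Matrix.mulVecLin_apply, ← key, ← Matrix.mulVecLin_apply, hvs]
    ext k
    simp [hr]

theorem ZMod.exists_span_singleton_eq_span_pow {l : ℕ} (hl : l.Prime) (e : ℕ)
    (a : ZMod (l ^ e)) :
    ∃ c ≤ e, Ideal.span {a} = Ideal.span {(l : ZMod (l ^ e)) ^ c} := by
  obtain ⟨z, rfl⟩ := ZMod.intCast_surjective a
  obtain ⟨c, hc, h⟩ := (Nat.dvd_prime_pow hl).1 (Int.gcd_dvd_natAbs_right z ((l ^ e : ℕ) : ℤ))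
  refine ⟨c, hc, le_antisymm ?_ ?_⟩ <;>
    rw [Ideal.span_singleton_le_span_singleton]
  · have hz : ((l ^ c : ℕ) : ℤ) ∣ z := h ▸ Int.gcd_dvd_left ..
    simpa using map_dvd (Int.castRingHom (ZMod (l ^ e))) hz
  · have hb := congrArg (Int.cast : ℤ → ZMod (l ^ e)) (Int.gcd_eq_gcd_ab z ((l ^ e : ℕ) : ℤ))
    rw [h] at hb
    refine ⟨(Int.gcdA z ((l ^ e : ℕ) : ℤ) : ZMod (l ^ e)), ?_⟩
    have h0 : (l : ZMod (l ^ e)) ^ e = 0 := by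
      rw [← Nat.cast_pow, ZMod.natCast_self]
    simpa [h0] using hb

theorem Submodule.map_permMatrix_pi {R ι : Type*} [CommRing R] [Fintype ι] [DecidableEq ι]
    (σ : Equiv.Perm ι) (I : ι → Ideal R) :
    (Submodule.pi Set.univ I).map (Matrix.mulVecLin (σ.permMatrix R)) =
      Submodule.pi Set.univ (I ∘ σ) := by
  ext v
  simp only [Submodule.mem_map, Matrix.mulVecLin_apply, Matrix.permMatrix_mulVec,
    Submodule.mem_pi, Set.mem_univ, true_imp_iff, Function.comp_apply]
  constructor
  · rintro ⟨w, hw, rfl⟩ k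
    exact hw (σ k)
  · intro hv
    refine ⟨v ∘ σ.symm, fun k => by simpa using hv (σ.symm k), ?_⟩
    ext k
    simp

/-- **Normal form for submodules of `(ℤ/l^eℤ)^m`.** Every `ℤ/l^eℤ`-submodule `W` of
`(ℤ/l^eℤ)^m` can be moved by an invertible change of basis `g ∈ GL_m(ℤ/l^eℤ)` to a
standard submodule: there are naturals `c_1 ≤ c_2 ≤ … ≤ c_m ≤ e` with
`g • W = { v | v_k ∈ (l^(c_k)) for all k }`, the product of the ideals generated by
the `l^(c_k)`. -/
theorem exists_smithNormalForm_submodule_zmod_primePow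
    (l : ℕ) (hl : l.Prime) (e m : ℕ) (he : 1 ≤ e) (hm : 1 ≤ m)
    (W : Submodule (ZMod (l ^ e)) (Fin m → ZMod (l ^ e))) :
    ∃ (g : GL (Fin m) (ZMod (l ^ e))) (c : Fin m → ℕ),
      Monotone c ∧ (∀ k, c k ≤ e) ∧
      Submodule.map (Matrix.mulVecLin g.val) W =
        Submodule.pi Set.univ
          (fun k : Fin m => Ideal.span {(l : ZMod (l ^ e)) ^ c k}) := by
  obtain ⟨g, a, hg⟩ := exists_GL_map_eq_pi_span_of_surjective
    (Int.castRingHom (ZMod (l ^ e))) ZMod.intCast_surjective W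
  choose c hc hac using fun k => ZMod.exists_span_singleton_eq_span_pow hl e (a k)
  let σ : Equiv.Perm (Fin m) := Tuple.sort c
  have hσ : IsUnit (σ.permMatrix (ZMod (l ^ e))).det := by
    rw [Matrix.det_permutation]
    exact (Equiv.Perm.sign σ).isUnit.map (Int.castRingHom (ZMod (l ^ e)))
  refine ⟨Matrix.GeneralLinearGroup.mk'' _ hσ * g, c ∘ σ, Tuple.monotone_sort c,
    fun k => hc (σ k), ?_⟩
  rw [Units.val_mul, Matrix.mulVecLin_mul, Submodule.map_comp, hg]
  simp_rw [hac]
  exact Submodule.map_permMatrix_pi σ _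
end
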